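/- arXiv:1403.1352 — 2 statements merged into one kernel-verified Lean document; each statement's English description precedes it below -/
import Mathlib

section
/- For every c₀ > 0 there exists C > 0 such that the following holds in ℝ³ for every integer N ≥ 2, every positive integer D, and every nonzero polynomial Q in 3 real variables of total degree at most D: if V ⊆ S² is a (1/N)-separated set of unit vectors such that for each v ∈ V there exists a line with direction v that intersects at least c₀·N of the closed grid cubes ∏_{i=1}^3 [k_i/N, (k_i+1)/N] (k ∈ ℤ³) contained in [0,1]³ in which Q has a zero, then |V| ≤ C·D²·N·(log N)². -/
/-- The closed grid cube of side `δ` indexed by `k ∈ ℤ³`. -/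
def gridCube3 (δ : ℝ) (k : Fin 3 → ℤ) : Set (EuclideanSpace ℝ (Fin 3)) :=
  {x | ∀ i, x i ∈ Set.Icc ((k i : ℝ) * δ) (((k i : ℝ) + 1) * δ)}

/-- The unit cube `[0,1]³`. -/
def unitCube3 : Set (EuclideanSpace ℝ (Fin 3)) :=
  {x | ∀ i, x i ∈ Set.Icc (0 : ℝ) 1}

namespace MvPolynomial

theorem totalDegree_pderiv_le {σ R : Type*} [CommSemiring R] (i : σ) (p : MvPolynomial σ R) :
    (pderiv i p).totalDegree ≤ p.totalDegree := by
  classical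
  conv_lhs => rw [p.as_sum, map_sum]
  refine totalDegree_finsetSum_le fun s hs => ?_
  rw [pderiv_monomial]
  refine (totalDegree_monomial_le _ _).trans ((?_ : _ ≤ _).trans (le_totalDegree hs))
  exact Finsupp.degree_mono tsub_le_self

theorem totalDegree_aeval_le_mul {σ τ R : Type*} [CommSemiring R] (g : σ → MvPolynomial τ R) (d : ℕ)
    (hg : ∀ i, (g i).totalDegree ≤ d) (p : MvPolynomial σ R) :
    (aeval g p).totalDegree ≤ p.totalDegree * d := by
  rw [aeval_def, eval₂_eq]
  refine totalDegree_finsetSum_le fun s hs => (totalDegree_mul _ _).trans ?_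
  rw [algebraMap_eq, totalDegree_C, zero_add]
  refine (totalDegree_finsetProd _ _).trans ?_
  calc ∑ i ∈ s.support, (g i ^ s i).totalDegree ≤ ∑ i ∈ s.support, s i * d :=
        Finset.sum_le_sum fun i _ => (totalDegree_pow _ _).trans (Nat.mul_le_mul_left _ (hg i))
    _ = (s.sum fun _ e => e) * d := by rw [Finsupp.sum, Finset.sum_mul]
    _ ≤ _ := Nat.mul_le_mul_right _ (le_totalDegree hs)

theorem hasDerivAt_eval_update {σ : Type*} [DecidableEq σ] (p : MvPolynomial σ ℝ) (x : σ → ℝ)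
    (i : σ) :
    HasDerivAt (fun t => eval (Function.update x i t) p) (eval x (pderiv i p)) (x i) := by
  induction p using MvPolynomial.induction_on with
  | C a => simpa using hasDerivAt_const (x i) a
  | add p q hp hq => simpa using hp.fun_add hq
  | mul_X p j hp =>
    have hX : HasDerivAt (fun t => Function.update x i t j) (if j = i then 1 else 0) (x i) := by
      by_cases h : j = i
      · subst h; simpa using hasDerivAt_id' (x j)
      · simpa [h] using hasDerivAt_const (x i) (x j)
    have := hp.fun_mul hX
    simp only [Function.update_eq_self] at this
    simp only [map_mul, eval_X, Derivation.leibniz, pderiv_X, smul_eq_mul, map_add, Pi.single_apply]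
    refine this.congr_deriv ?_
    by_cases h : j = i
    · subst h; simp; ring
    · simp [h, mul_comm]

/-- Polynomials `f i` in `n` variables and one further polynomial `l` satisfy an algebraic
relation of degree at most `e` in `l` as soon as `(n * d + 1) ^ n ≤ e`, where `d` bounds the
degrees of the `f i`. -/
theorem exists_relation {σ : Type*} [Fintype σ] (f : σ → MvPolynomial σ ℝ) (d : ℕ)
    (hf : ∀ i, (f i).totalDegree ≤ d) (l : MvPolynomial σ ℝ) (e : ℕ)
    (he : (Fintype.card σ * d + 1) ^ Fintype.card σ ≤ e) :
    ∃ a : Fin (e + 1) → MvPolynomial σ ℝ, a ≠ 0 ∧ ∑ j, aeval f (a j) * l ^ (j : ℕ) = 0 := by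
  classical
  set n := Fintype.card σ
  set B := e * l.totalDegree + 1 with hB
  set K := (n * d + 1) * B with hK
  let g : ((σ → Fin B) × Fin (e + 1)) → MvPolynomial σ ℝ :=
    fun c => (∏ i, f i ^ (c.1 i : ℕ)) * l ^ (c.2 : ℕ)
  have hg : ∀ c, (g c).totalDegree < K := by
    intro c
    have h1 : (∏ i, f i ^ (c.1 i : ℕ)).totalDegree ≤ n * (d * (e * l.totalDegree)) := by
      refine (totalDegree_finsetProd _ _).trans ?_
      refine (Finset.sum_le_card_nsmul _ _ (d * (e * l.totalDegree)) fun i _ => ?_).trans ?_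
      · refine (totalDegree_pow _ _).trans ?_
        rw [mul_comm d]
        exact Nat.mul_le_mul (by have := (c.1 i).2; omega) (hf i)
      · simp [n]
    have h2 : (l ^ (c.2 : ℕ)).totalDegree ≤ e * l.totalDegree :=
      (totalDegree_pow _ _).trans (Nat.mul_le_mul_right _ (by have := c.2.2; omega))
    refine (totalDegree_mul _ _).trans_lt ?_
    calc _ ≤ n * (d * (e * l.totalDegree)) + e * l.totalDegree := Nat.add_le_add h1 h2
      _ < K := by rw [hK, hB]; nlinarith
  let Φ : (((σ → Fin B) × Fin (e + 1)) → ℝ) →ₗ[ℝ] MvPolynomial σ ℝ := Fintype.linearCombination ℝ g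
  let E : (σ → Fin K) → (σ →₀ ℕ) := fun s => Finsupp.equivFunOnFinite.symm fun i => (s i : ℕ)
  let Ψ : MvPolynomial σ ℝ →ₗ[ℝ] ((σ → Fin K) → ℝ) := LinearMap.pi fun s => lcoeff ℝ (E s)
  have hdim : Module.finrank ℝ ((σ → Fin K) → ℝ) <
      Module.finrank ℝ (((σ → Fin B) × Fin (e + 1)) → ℝ) := by
    simp only [Module.finrank_fintype_fun_eq_card, Fintype.card_prod, Fintype.card_fun,
      Fintype.card_fin]
    rw [hK, mul_pow, mul_comm]
    exact Nat.mul_lt_mul_of_pos_left (Nat.lt_succ_of_le he) (by positivity)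
  obtain ⟨c, hc, hc0⟩ := (Submodule.ne_bot_iff _).1
    (LinearMap.ker_ne_bot_of_finrank_lt (f := Ψ ∘ₗ Φ) hdim)
  have hΦ : Φ c = 0 := by
    ext s
    rw [coeff_zero]
    by_cases hs : ∀ i, s i < K
    · have := congrFun (LinearMap.mem_ker.1 hc) (fun i => ⟨s i, hs i⟩)
      simpa [Ψ, E, lcoeff] using this
    · push Not at hs
      obtain ⟨i, hi⟩ := hs
      apply coeff_eq_zero_of_totalDegree_lt
      have h1 : (Φ c).totalDegree < K := by
        refine Nat.lt_of_le_pred (by positivity) ?_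
        simp only [Φ, Fintype.linearCombination_apply]
        refine totalDegree_finsetSum_le fun k _ => (totalDegree_smul_le _ _).trans ?_
        exact Nat.le_pred_of_lt (hg k)
      refine h1.trans_le (hi.trans ?_)
      by_cases h0 : s i = 0
      · omega
      exact Finset.single_le_sum (f := fun i => s i) (fun _ _ => Nat.zero_le _)
        (Finsupp.mem_support_iff.2 h0)
  let F : (σ → Fin B) → (σ →₀ ℕ) := fun s => Finsupp.equivFunOnFinite.symm fun i => (s i : ℕ)
  have hF : Function.Injective F := by
    intro s t h
    ext i
    simpa [F] using DFunLike.congr_fun h i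
  refine ⟨fun j => ∑ b, monomial (F b) (c (b, j)), ?_, ?_⟩
  · intro h
    apply hc0
    ext ⟨b, j⟩
    have := congrArg (coeff (F b)) (congrFun h j)
    simpa [coeff_sum, coeff_monomial, hF.eq_iff] using this
  · rw [← hΦ]
    simp only [Φ, Fintype.linearCombination_apply, Fintype.sum_prod_type, map_sum, aeval_monomial,
      Finset.sum_mul]
    rw [Finset.sum_comm]
    refine Finset.sum_congr rfl fun b _ => Finset.sum_congr rfl fun j _ => ?_
    rw [Finsupp.prod_fintype _ _ (by simp)]
    simp [g, F, Algebra.smul_def, mul_assoc]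

end MvPolynomial

/-- Finitely many points with pairwise distinct positions are separated by one of the linear forms
`x ↦ ∑ j, s ^ j * x j` with `s` in a range depending only on the number of points. -/
theorem exists_separating_linear_form {σ ι : Type*} [Fintype σ] [Fintype ι]
    (x : ι → σ → ℝ) (hx : Function.Injective x) :
    ∃ s ∈ Finset.range (Fintype.card ι * Fintype.card ι * Fintype.card σ + 1),
      Function.Injective fun i => ∑ j, (s : ℝ) ^ (Fintype.equivFin σ j : ℕ) * x i j := by
  classical
  let q : ι → ι → Polynomial ℝ := fun i i' =>
    ∑ j, Polynomial.C (x i j - x i' j) * Polynomial.X ^ (Fintype.equivFin σ j : ℕ)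
  have hq : ∀ i i', i ≠ i' → q i i' ≠ 0 := by
    intro i i' hne h
    apply hne
    apply hx
    ext j
    have := congrArg (fun p => Polynomial.coeff p (Fintype.equivFin σ j : ℕ)) h
    simp only [q, Polynomial.finsetSum_coeff, Polynomial.coeff_C_mul, Polynomial.coeff_X_pow,
      Fin.val_inj, EmbeddingLike.apply_eq_iff_eq, mul_ite, mul_one, mul_zero,
      Finset.sum_ite_eq, Finset.mem_univ, if_true, Polynomial.coeff_zero] at this
    linarith
  have hdeg : ∀ i i', (q i i').natDegree ≤ Fintype.card σ := fun i i' =>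
    Polynomial.natDegree_sum_le_of_forall_le _ _ fun j _ =>
      (Polynomial.natDegree_C_mul_X_pow_le _ _).trans (Fintype.equivFin σ j).2.le
  let P : Polynomial ℝ := ∏ c ∈ (Finset.univ : Finset ι).offDiag, q c.1 c.2
  have hP : P ≠ 0 := Finset.prod_ne_zero_iff.2 fun c hc => hq _ _ (Finset.mem_offDiag.1 hc).2.2
  have hPdeg : P.natDegree ≤ Fintype.card ι * Fintype.card ι * Fintype.card σ := by
    refine (Polynomial.natDegree_prod_le _ _).trans ?_
    refine (Finset.sum_le_card_nsmul _ _ _ fun c _ => hdeg c.1 c.2).trans ?_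
    rw [Finset.offDiag_card, smul_eq_mul, Finset.card_univ]
    exact Nat.mul_le_mul_right _ (Nat.sub_le _ _)
  by_contra! hcon
  apply hP
  refine Polynomial.eq_zero_of_natDegree_lt_card_of_eval_eq_zero' P
    ((Finset.range (Fintype.card ι * Fintype.card ι * Fintype.card σ + 1)).image
      (Nat.cast : ℕ → ℝ)) ?_ ?_
  · intro t ht
    obtain ⟨s, hs, rfl⟩ := Finset.mem_image.1 ht
    have := hcon s hs
    simp only [Function.Injective, not_forall] at this
    obtain ⟨i, i', heq, hne⟩ := this
    rw [Polynomial.eval_prod]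
    refine Finset.prod_eq_zero (i := (i, i')) (by simp [hne]) ?_
    simp only [q, Polynomial.eval_finsetSum, Polynomial.eval_mul, Polynomial.eval_C,
      Polynomial.eval_pow, Polynomial.eval_X, sub_mul, Finset.sum_sub_distrib]
    rw [sub_eq_zero]
    simpa [mul_comm] using heq
  · rw [Finset.card_image_of_injective _ Nat.cast_injective, Finset.card_range]
    omega

namespace MvPolynomial

open Filter Topology

/-- If a polynomial has a zero in a compact set but none on its frontier, then every small vector is
the gradient of the square of the polynomial at some interior point. -/
theorem eventually_exists_gradient_eq {σ : Type*} [Fintype σ] (p : MvPolynomial σ ℝ)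
    {K : Set (σ → ℝ)} (hK : IsCompact K) (h0 : ∃ x ∈ K, eval x p = 0)
    (hfr : ∀ x ∈ K, eval x p = 0 → x ∈ interior K) :
    ∀ᶠ y : σ → ℝ in 𝓝 0, ∃ x ∈ interior K, ∀ i, eval x (pderiv i (p ^ 2)) = y i := by
  classical
  obtain ⟨z, hzK, hz⟩ := h0
  let h : (σ → ℝ) → (σ → ℝ) → ℝ := fun y x => eval x (p ^ 2) - ∑ i, y i * (x i - z i)
  have hcont : Continuous fun w : (σ → ℝ) × (σ → ℝ) => h w.1 w.2 := by
    have : Continuous fun w : (σ → ℝ) × (σ → ℝ) => eval w.2 (p ^ 2) :=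
      (continuous_eval (p ^ 2)).comp continuous_snd
    simp only [h]
    fun_prop
  have hpos : ∀ᶠ y in 𝓝 (0 : σ → ℝ), ∀ x ∈ K \ interior K, 0 < h y x := by
    refine (hK.diff isOpen_interior).eventually_forall_of_forall_eventually fun x hx => ?_
    refine hcont.continuousAt.eventually (lt_mem_nhds ?_)
    have : eval x p ≠ 0 := fun h => hx.2 (hfr x hx.1 h)
    simp only [h, map_pow, Pi.zero_apply, zero_mul, Finset.sum_const_zero, sub_zero]
    positivity
  filter_upwards [hpos] with y hy
  obtain ⟨x, hxK, hmin⟩ := hK.exists_isMinOn ⟨z, hzK⟩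
    (hcont.comp (Continuous.prodMk_right y)).continuousOn
  have hxle : h y x ≤ 0 := by
    refine (hmin hzK).trans_eq ?_
    simp [h, hz]
  have hxint : x ∈ interior K := by
    by_contra hx
    exact (hy x ⟨hxK, hx⟩).not_ge hxle
  refine ⟨x, hxint, fun i => ?_⟩
  have hloc : IsLocalMin (h y) x := hmin.isLocalMin (mem_interior_iff_mem_nhds.1 hxint)
  have hupd : Continuous fun t => Function.update x i t := continuous_const.update i continuous_id
  have hloc' : IsLocalMin (fun t => h y (Function.update x i t)) (x i) := by
    have := hupd.tendsto (x i)
    rw [Function.update_eq_self] at this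
    have := this.eventually hloc
    simpa [IsLocalMin, IsMinFilter] using this
  have hlin : HasDerivAt (fun t => ∑ j, y j * (Function.update x i t j - z j)) (y i) (x i) := by
    have : HasDerivAt (fun t => ∑ j, y j * (Function.update x i t j - z j))
        (∑ j, y j * (if j = i then 1 else 0)) (x i) := by
      refine HasDerivAt.fun_sum fun j _ => ?_
      refine HasDerivAt.const_mul _ (HasDerivAt.sub_const _ ?_)
      by_cases h : j = i
      · subst h; simpa using hasDerivAt_id' (x j)
      · simpa [h] using hasDerivAt_const (x i) (x j)
    simpa using this
  have := hloc'.hasDerivAt_eq_zero ((hasDerivAt_eval_update (p ^ 2) x i).fun_sub hlin)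
  linarith

/-- A polynomial of degree at most `D` in `n` variables has zeros in, but not on the frontier of, at
most `(2 n D + 1) ^ n` compact sets with disjoint interiors. -/
theorem card_isolating_compacts_le {σ ι : Type*} [Fintype σ] [Fintype ι] (p : MvPolynomial σ ℝ)
    (D : ℕ) (hp : p.totalDegree ≤ D) (K : ι → Set (σ → ℝ)) (hK : ∀ i, IsCompact (K i))
    (hdisj : ∀ i j, i ≠ j → Disjoint (interior (K i)) (interior (K j)))
    (h0 : ∀ i, ∃ x ∈ K i, eval x p = 0)
    (hfr : ∀ i, ∀ x ∈ K i, eval x p = 0 → x ∈ interior (K i)) :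
    Fintype.card ι ≤ (Fintype.card σ * (2 * D) + 1) ^ Fintype.card σ := by
  classical
  set e := (Fintype.card σ * (2 * D) + 1) ^ Fintype.card σ with he
  let f : σ → MvPolynomial σ ℝ := fun i => pderiv i (p ^ 2)
  have hf : ∀ i, (f i).totalDegree ≤ 2 * D := fun i =>
    (totalDegree_pderiv_le _ _).trans ((totalDegree_pow _ _).trans (Nat.mul_le_mul_left _ hp))
  let l : ℕ → MvPolynomial σ ℝ := fun s =>
    ∑ j, C ((s : ℝ) ^ (Fintype.equivFin σ j : ℕ)) * X j
  choose a ha hrel using fun s => exists_relation f (2 * D) hf (l s) e he.ge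
  have ha' : ∀ s, ∃ j, a s j ≠ 0 := fun s => Function.ne_iff.1 (ha s)
  choose j hj using ha'
  set R := Finset.range (Fintype.card ι * Fintype.card ι * Fintype.card σ + 1)
  have hA : ∏ s ∈ R, a s (j s) ≠ 0 := Finset.prod_ne_zero_iff.2 fun s _ => hj s
  have hev : ∀ᶠ y : σ → ℝ in 𝓝 0, ∀ i, ∃ x ∈ interior (K i), ∀ k, eval x (f k) = y k :=
    eventually_all.2 fun i => eventually_exists_gradient_eq p (hK i) (h0 i) (hfr i)
  obtain ⟨ε, hε, hball⟩ := Metric.eventually_nhds_iff.1 hev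
  obtain ⟨y, hy, hyA⟩ : ∃ y ∈ Set.pi Set.univ fun _ : σ => Set.Ioo (-(ε / 2)) (ε / 2),
      eval y (∏ s ∈ R, a s (j s)) ≠ 0 := by
    by_contra! hcon
    exact hA (funext_set _ (fun _ => Set.Ioo_infinite (show -(ε / 2) < ε / 2 by linarith)) fun x hx => by
      rw [hcon x hx, map_zero])
  have hdist : dist y 0 < ε := by
    refine lt_of_le_of_lt ((dist_pi_le_iff (by linarith)).2 fun k => ?_) (half_lt_self hε)
    rw [Pi.zero_apply, Real.dist_0_eq_abs]
    exact abs_le.2 ⟨(hy k trivial).1.le, (hy k trivial).2.le⟩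
  choose x hxK hx using hball hdist
  have hinj : Function.Injective x := by
    intro i i' h
    by_contra hne
    exact Set.disjoint_left.1 (hdisj i i' hne) (hxK i) (h ▸ hxK i')
  obtain ⟨s, hs, hsep⟩ := exists_separating_linear_form x hinj
  rw [map_prod, Finset.prod_ne_zero_iff] at hyA
  let q : Polynomial ℝ :=
    ∑ k : Fin (e + 1), Polynomial.C (eval y (a s k)) * Polynomial.X ^ (k : ℕ)
  have hqdeg : q.natDegree ≤ e := Polynomial.natDegree_sum_le_of_forall_le _ _ fun k _ =>
      (Polynomial.natDegree_C_mul_X_pow_le _ _).trans (by omega)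
  have hq0 : q ≠ 0 := by
    intro h
    apply hyA s hs
    have := congrArg (fun p => Polynomial.coeff p (j s : ℕ)) h
    simpa only [q, Polynomial.finsetSum_coeff, Polynomial.coeff_C_mul, Polynomial.coeff_X_pow,
      Fin.val_inj, mul_ite, mul_one, mul_zero, Finset.sum_ite_eq, Finset.mem_univ, if_true,
      Polynomial.coeff_zero] using this
  by_contra! hlt
  refine hq0 (Polynomial.eq_zero_of_natDegree_lt_card_of_eval_eq_zero q hsep (fun i => ?_)
    (hqdeg.trans_lt hlt))
  have := congrArg (eval (x i)) (hrel s)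
  simp only [map_sum, map_mul, map_pow, map_zero] at this
  rw [Polynomial.eval_finsetSum, ← this]
  refine Finset.sum_congr rfl fun k _ => ?_
  have h1 : eval (x i) (aeval f (a s k)) = eval y (a s k) := by
    have : y = fun k => eval (x i) (f k) := (_root_.funext (hx i)).symm
    rw [this]
    simpa only [← coe_aeval_eq_eval, RingHom.coe_coe] using comp_aeval_apply f (aeval (x i)) (a s k)
  rw [h1]
  simp [l]

end MvPolynomial

/-- The face of the closed grid cube with corner `δ k` spanned by the coordinates in `I`. -/
def gridFace {n : ℕ} (δ : ℝ) (I : Finset (Fin n)) (k : Fin n → ℤ) : Set (Fin n → ℝ) :=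
  {y | ∀ j, if j ∈ I then y j ∈ Set.Icc ((k j : ℝ) * δ) (((k j : ℝ) + 1) * δ)
    else y j = (k j : ℝ) * δ}

/-- A grid face which contains a zero of `Q`, while its relative boundary does not. -/
def IsIsolatingFace {n : ℕ} (Q : MvPolynomial (Fin n) ℝ) (δ : ℝ) (I : Finset (Fin n))
    (k : Fin n → ℤ) : Prop :=
  (∃ y ∈ gridFace δ I k, MvPolynomial.eval y Q = 0) ∧
    ∀ y ∈ gridFace δ I k, MvPolynomial.eval y Q = 0 →
      ∀ j ∈ I, y j ∈ Set.Ioo ((k j : ℝ) * δ) (((k j : ℝ) + 1) * δ)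

theorem exists_isIsolatingFace {n : ℕ} (Q : MvPolynomial (Fin n) ℝ) (δ : ℝ) (k : Fin n → ℤ)
    (h : ∃ y : Fin n → ℝ, (∀ j, y j ∈ Set.Icc ((k j : ℝ) * δ) (((k j : ℝ) + 1) * δ)) ∧
      MvPolynomial.eval y Q = 0) :
    ∃ I J : Finset (Fin n), IsIsolatingFace Q δ I fun j => k j + if j ∈ J then 1 else 0 := by
  classical
  let μ : (Fin n → ℝ) → ℕ := fun y =>
    (Finset.univ.filter fun j => y j ∈ Set.Ioo ((k j : ℝ) * δ) (((k j : ℝ) + 1) * δ)).card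
  obtain ⟨y, ⟨hyk, hy0⟩, hmin⟩ := (measure μ).wf.has_min
    {y : Fin n → ℝ | (∀ j, y j ∈ Set.Icc ((k j : ℝ) * δ) (((k j : ℝ) + 1) * δ)) ∧
      MvPolynomial.eval y Q = 0} h
  set I := Finset.univ.filter fun j => y j ∈ Set.Ioo ((k j : ℝ) * δ) (((k j : ℝ) + 1) * δ) with hI
  set J := Finset.univ.filter fun j => y j = ((k j : ℝ) + 1) * δ with hJ
  have hIJ : ∀ j ∈ I, j ∉ J := by
    intro j hj hj'
    simp only [hI, hJ, Finset.mem_filter, Finset.mem_univ, true_and] at hj hj'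
    exact hj.2.ne hj'
  have hnI : ∀ j, j ∉ I → y j = ((k j + if j ∈ J then 1 else 0 : ℤ) : ℝ) * δ := by
    intro j hj
    by_cases hJj : j ∈ J
    · have := (Finset.mem_filter.1 hJj).2
      simp [hJj, this]
    · have h1 : y j ≠ ((k j : ℝ) + 1) * δ := fun h => hJj (by simp [hJ, h])
      have h2 : ¬ (y j ∈ Set.Ioo ((k j : ℝ) * δ) (((k j : ℝ) + 1) * δ)) := fun h =>
        hj (by simpa [hI] using h)
      have h3 := hyk j
      simp only [hJj, if_false, add_zero]
      by_contra hne
      exact h2 ⟨lt_of_le_of_ne h3.1 (Ne.symm hne), lt_of_le_of_ne h3.2 h1⟩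
  refine ⟨I, J, ⟨y, fun j => ?_, hy0⟩, fun z hz hz0 j₀ hj₀ => ?_⟩
  · by_cases hj : j ∈ I
    · simpa [hj, hIJ j hj] using hyk j
    · simpa only [hj, if_false] using hnI j hj
  · by_contra hcon
    have hzI : ∀ j ∈ I, z j ∈ Set.Icc ((k j : ℝ) * δ) (((k j : ℝ) + 1) * δ) := by
      intro j hj
      simpa [hj, hIJ j hj] using hz j
    have hzn : ∀ j, j ∉ I → z j = y j := by
      intro j hj
      have := hz j
      simp only [hj, if_false] at this
      rw [this, hnI j hj]
    refine hmin z ⟨fun j => ?_, hz0⟩ ?_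
    · by_cases hj : j ∈ I
      · exact hzI j hj
      · rw [hzn j hj]; exact hyk j
    · refine Finset.card_lt_card (Finset.ssubset_iff_of_subset (fun j hj => ?_) |>.2 ⟨j₀, hj₀, ?_⟩)
      · by_contra hjI
        rw [Finset.mem_filter, hzn j hjI] at hj
        exact hjI (Finset.mem_filter.2 hj)
      · simpa [hIJ j₀ hj₀] using hcon

theorem card_grid_zeros_le {n : ℕ} (Q : MvPolynomial (Fin n) ℝ) (hQ : Q ≠ 0) (D : ℕ)
    (hD : Q.totalDegree ≤ D) {δ : ℝ} (hδ : 0 < δ) (b : Fin n → ℤ) (m : ℕ) :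
    (Finset.card {k ∈ Fintype.piFinset fun j => Finset.Icc (b j) (b j + m) |
      MvPolynomial.eval (fun j => (k j : ℝ) * δ) Q = 0}) * (m + 1) ≤ n * D * (m + 1) ^ n := by
  classical
  have hinj : Function.Injective fun k : ℤ => (k : ℝ) * δ := fun k l h => by
    simpa [hδ.ne'] using h
  let S : Fin n → Finset ℝ := fun j => (Finset.Icc (b j) (b j + m)).image fun k : ℤ => (k : ℝ) * δ
  have hS : ∀ j, (S j).card = m + 1 := by
    intro j
    rw [Finset.card_image_of_injective _ hinj, Int.card_Icc]
    omega
  have hle : Finset.card {k ∈ Fintype.piFinset fun j => Finset.Icc (b j) (b j + m) |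
      MvPolynomial.eval (fun j => (k j : ℝ) * δ) Q = 0} ≤
      Finset.card {x ∈ Fintype.piFinset S | MvPolynomial.eval x Q = 0} := by
    refine Finset.card_le_card_of_injOn (fun k j => (k j : ℝ) * δ) (fun k hk => ?_) ?_
    · rw [Finset.mem_coe, Finset.mem_filter, Fintype.mem_piFinset] at hk ⊢
      exact ⟨fun j => Finset.mem_image_of_mem _ (hk.1 j), hk.2⟩
    · intro k _ l _ h
      ext j
      exact hinj (congrFun h j)
  have hsz := MvPolynomial.schwartz_zippel_sum_degreeOf hQ S
  simp only [hS, Finset.prod_const, Finset.card_univ, Fintype.card_fin] at hsz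
  have hsz' : (Finset.card {x ∈ Fintype.piFinset S | MvPolynomial.eval x Q = 0} : ℚ≥0) * (m + 1) ≤
      n * D * (m + 1) ^ n := by
    have h1 : ∑ i : Fin n, (Q.degreeOf i / ((m + 1 : ℕ) : ℚ≥0) : ℚ≥0) ≤ n * D / (m + 1) := by
      refine (Finset.sum_le_card_nsmul _ _ (D / (m + 1) : ℚ≥0) fun i _ => ?_).trans_eq ?_
      · push_cast
        gcongr
        exact (MvPolynomial.degreeOf_le_totalDegree _ _).trans hD
      · simp [mul_div_assoc]
    have h2 := hsz.trans h1
    rw [div_le_div_iff₀ (by positivity) (by positivity)] at h2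
    exact_mod_cast h2
  exact (Nat.mul_le_mul_right _ hle).trans (by exact_mod_cast hsz')

open Classical in
theorem card_isIsolatingFace_fiber_le {n : ℕ} (Q : MvPolynomial (Fin n) ℝ) (D : ℕ)
    (hD : Q.totalDegree ≤ D) {δ : ℝ} (I : Finset (Fin n)) (k₀ : Fin n → ℤ)
    (T : Finset (Fin n → ℤ)) (hT : ∀ k ∈ T, IsIsolatingFace Q δ I k)
    (hT₀ : ∀ k ∈ T, ∀ j, j ∉ I → k j = k₀ j) :
    T.card ≤ (I.card * (2 * D) + 1) ^ I.card := by
  let g : Fin n → MvPolynomial I ℝ := fun j =>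
    if h : j ∈ I then MvPolynomial.X ⟨j, h⟩ else MvPolynomial.C ((k₀ j : ℝ) * δ)
  let ext : (I → ℝ) → (Fin n → ℝ) := fun z j => if h : j ∈ I then z ⟨j, h⟩ else (k₀ j : ℝ) * δ
  have heval : ∀ z, MvPolynomial.eval z (MvPolynomial.aeval g Q) =
      MvPolynomial.eval (ext z) Q := by
    intro z
    have h1 : ext z = fun j => MvPolynomial.aeval z (g j) := by
      ext j
      by_cases h : j ∈ I <;> simp [ext, g, h]
    rw [h1]
    simpa only [← MvPolynomial.coe_aeval_eq_eval, RingHom.coe_coe] using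
      MvPolynomial.comp_aeval_apply g (MvPolynomial.aeval z) Q
  have hext : ∀ k ∈ T, ∀ z : I → ℝ,
      z ∈ Set.pi Set.univ (fun j : I => Set.Icc ((k j : ℝ) * δ) (((k j : ℝ) + 1) * δ)) →
      ext z ∈ gridFace δ I k := by
    intro k hk z hz j
    by_cases h : j ∈ I
    · simpa [h, ext] using hz ⟨j, h⟩ trivial
    · simp [h, ext, hT₀ k hk j h]
  have hdeg : (MvPolynomial.aeval g Q).totalDegree ≤ D := by
    refine (MvPolynomial.totalDegree_aeval_le_mul g 1 (fun j => ?_) Q).trans (by simpa using hD)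
    by_cases h : j ∈ I
    · simp [g, h]
    · simp only [g, h, dif_neg, not_false_eq_true, MvPolynomial.totalDegree_C, zero_le]
  have hint : ∀ k : Fin n → ℤ, interior (Set.pi Set.univ
      (fun j : I => Set.Icc ((k j : ℝ) * δ) (((k j : ℝ) + 1) * δ))) =
      Set.pi Set.univ (fun j : I => Set.Ioo ((k j : ℝ) * δ) (((k j : ℝ) + 1) * δ)) := by
    intro k
    rw [interior_pi_set Set.finite_univ]
    simp only [interior_Icc]
  have := MvPolynomial.card_isolating_compacts_le (ι := T) (MvPolynomial.aeval g Q) D hdeg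
    (fun k => Set.pi Set.univ
      (fun j : I => Set.Icc ((k.1 j : ℝ) * δ) (((k.1 j : ℝ) + 1) * δ)))
    (fun k => isCompact_univ_pi fun j => isCompact_Icc) ?_ ?_ ?_
  · simpa using this
  · rintro ⟨k, hk⟩ ⟨l, hl⟩ hne
    rw [hint, hint, Set.disjoint_left]
    intro z hz hz'
    refine hne (Subtype.ext (_root_.funext fun j => ?_))
    by_cases h : j ∈ I
    · have h1 := hz ⟨j, h⟩ trivial
      have h2 := hz' ⟨j, h⟩ trivial
      simp only [Set.mem_Ioo] at h1 h2
      have hδ : 0 < δ := by linarith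
      have h3 : (k j : ℝ) < (l j : ℝ) + 1 := lt_of_mul_lt_mul_right (h1.1.trans h2.2) hδ.le
      have h4 : (l j : ℝ) < (k j : ℝ) + 1 := lt_of_mul_lt_mul_right (h2.1.trans h1.2) hδ.le
      have h5 : k j < l j + 1 := by exact_mod_cast h3
      have h6 : l j < k j + 1 := by exact_mod_cast h4
      show k j = l j
      omega
    · show k j = l j
      rw [hT₀ k hk j h, hT₀ l hl j h]
  · rintro ⟨k, hk⟩
    obtain ⟨y, hy, hy0⟩ := (hT k hk).1
    refine ⟨fun j => y j, fun j _ => by simpa using hy j, ?_⟩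
    rw [heval]
    convert hy0
    ext j
    by_cases h : j ∈ I
    · simp [ext, h]
    · have := hy j
      simp only [h, if_false] at this
      simp [ext, h, this, hT₀ k hk j h]
  · rintro ⟨k, hk⟩ z hz hz0
    rw [hint]
    rw [heval] at hz0
    intro j _
    have := (hT k hk).2 _ (hext k hk z hz) hz0 j j.2
    simpa [ext] using this

open Classical in
theorem card_isIsolatingFace_le {n : ℕ} (Q : MvPolynomial (Fin n) ℝ) (D : ℕ)
    (hD : Q.totalDegree ≤ D) {δ : ℝ} (I : Finset (Fin n)) (b : Fin n → ℤ) (m : ℕ) :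
    Finset.card {k ∈ Fintype.piFinset fun j => Finset.Icc (b j) (b j + m) |
      IsIsolatingFace Q δ I k} ≤
      (I.card * (2 * D) + 1) ^ I.card * (m + 1) ^ (n - I.card) := by
  let r : (Fin n → ℤ) → Fin n → ℤ := fun k j => if j ∈ I then 0 else k j
  refine Finset.card_le_mul_card_image_of_maps_to (f := r)
    (t := Fintype.piFinset fun j => if j ∈ I then {0} else Finset.Icc (b j) (b j + m))
    (fun k hk => ?_) _ (fun c _ => ?_) |>.trans (Nat.mul_le_mul_left _ ?_)
  · rw [Finset.mem_filter, Fintype.mem_piFinset] at hk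
    rw [Fintype.mem_piFinset]
    intro j
    by_cases h : j ∈ I
    · simp [r, h]
    · simpa [r, h] using hk.1 j
  · refine card_isIsolatingFace_fiber_le Q D hD (δ := δ) I c _ (fun k hk => ?_) fun k hk j hj => ?_
    · exact (Finset.mem_filter.1 (Finset.mem_filter.1 hk).1).2
    · have := congrFun (Finset.mem_filter.1 hk).2 j
      simpa [r, hj] using this
  · rw [Fintype.card_piFinset]
    have : ∀ j, (if j ∈ I then ({0} : Finset ℤ) else Finset.Icc (b j) (b j + m)).card =
        if j ∈ I then 1 else m + 1 := by
      intro j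
      split_ifs
      · simp
      · rw [Int.card_Icc]; omega
    simp only [this]
    rw [Finset.prod_ite]
    simp [Finset.filter_not, Finset.card_sdiff]

open Classical in
/-- **Wongkew's bound** for grid cubes: among `m ^ n` grid cubes forming a large cube, the zero set
of a nonzero polynomial of degree at most `D` meets at most `O(D m ^ (n - 1))`. -/
theorem card_gridCubes_zero_le {n : ℕ} (hn : 0 < n) (Q : MvPolynomial (Fin n) ℝ) (hQ : Q ≠ 0)
    (D : ℕ) (hD₀ : 0 < D) (hD : Q.totalDegree ≤ D) {δ : ℝ} (hδ : 0 < δ) (b : Fin n → ℤ) (m : ℕ)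
    (hm : 0 < m) :
    Finset.card {k ∈ Fintype.piFinset fun j => Finset.Ico (b j) (b j + m) |
      ∃ y : Fin n → ℝ, (∀ j, y j ∈ Set.Icc ((k j : ℝ) * δ) (((k j : ℝ) + 1) * δ)) ∧
        MvPolynomial.eval y Q = 0} ≤
      4 ^ n * (3 * n + 2) ^ n * D * m ^ (n - 1) := by
  obtain hmD | hDm := le_total m D
  · refine (Finset.card_filter_le _ _).trans ?_
    have h1 : (Fintype.piFinset fun j => Finset.Ico (b j) (b j + m)).card = m ^ n := by
      simp
    calc _ = m * m ^ (n - 1) := by rw [h1, ← pow_succ', Nat.sub_add_cancel hn]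
      _ ≤ D * m ^ (n - 1) := Nat.mul_le_mul_right _ hmD
      _ ≤ 4 ^ n * (3 * n + 2) ^ n * (D * m ^ (n - 1)) := Nat.le_mul_of_pos_left _ (by positivity)
      _ = _ := by ring
  let F : Finset (Fin n) → Finset (Fin n → ℤ) := fun I =>
    {k ∈ Fintype.piFinset fun j => Finset.Icc (b j) (b j + m) | IsIsolatingFace Q δ I k}
  have hF : ∀ I, (F I).card ≤ (3 * n + 2) ^ n * D * m ^ (n - 1) := by
    intro I
    obtain rfl | hI := I.eq_empty_or_nonempty
    · have h1 : (F ∅).card ≤ Finset.card {k ∈ Fintype.piFinset fun j => Finset.Icc (b j) (b j + m) |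
          MvPolynomial.eval (fun j => (k j : ℝ) * δ) Q = 0} := by
        refine Finset.card_le_card (Finset.monotone_filter_right _ fun k _ hk => ?_)
        obtain ⟨y, hy, hy0⟩ := hk.1
        have h : (fun j => (k j : ℝ) * δ) = y := _root_.funext fun j => by simpa using (hy j).symm
        rwa [h]
      have h2 := card_grid_zeros_le Q hQ D hD hδ b m
      have h3 : (F ∅).card ≤ n * D * (m + 1) ^ (n - 1) := by
        refine Nat.le_of_mul_le_mul_right (((Nat.mul_le_mul_right _ h1).trans h2).trans_eq ?_)
          (Nat.succ_pos m)
        rw [mul_assoc (n * D), ← pow_succ, Nat.sub_add_cancel hn]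
      calc _ ≤ _ := h3
        _ ≤ n * D * (2 * m) ^ (n - 1) := by gcongr; omega
        _ = n * 2 ^ (n - 1) * D * m ^ (n - 1) := by rw [mul_pow]; ring
        _ ≤ (3 * n + 2) * (3 * n + 2) ^ (n - 1) * D * m ^ (n - 1) := by gcongr <;> omega
        _ = _ := by rw [← pow_succ', Nat.sub_add_cancel hn]
    · have hIn : I.card ≤ n := by simpa using Finset.card_le_univ I
      have hI0 : 0 < I.card := hI.card_pos
      refine (card_isIsolatingFace_le Q D hD I b m).trans ?_
      calc (I.card * (2 * D) + 1) ^ I.card * (m + 1) ^ (n - I.card)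
          ≤ ((3 * n + 2) * D) ^ I.card * ((3 * n + 2) * m) ^ (n - I.card) := by
            gcongr
            · nlinarith
            · nlinarith
        _ = (3 * n + 2) ^ n * (D * D ^ (I.card - 1)) * m ^ (n - I.card) := by
            rw [mul_pow, mul_pow, ← pow_succ', Nat.sub_add_cancel hI0]
            have h : (3 * n + 2) ^ n = (3 * n + 2) ^ I.card * (3 * n + 2) ^ (n - I.card) := by
              rw [← pow_add, Nat.add_sub_cancel' hIn]
            rw [h]; ring
        _ ≤ (3 * n + 2) ^ n * (D * m ^ (I.card - 1)) * m ^ (n - I.card) := by gcongr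
        _ = _ := by
            rw [← mul_assoc, mul_assoc, ← pow_add]
            congr 2
            omega
  have hsub : ({k ∈ Fintype.piFinset fun j => Finset.Ico (b j) (b j + m) |
      ∃ y : Fin n → ℝ, (∀ j, y j ∈ Set.Icc ((k j : ℝ) * δ) (((k j : ℝ) + 1) * δ)) ∧
        MvPolynomial.eval y Q = 0} : Finset _) ⊆
      (Finset.univ : Finset (Finset (Fin n) × Finset (Fin n))).biUnion fun c =>
        (F c.1).image fun k j => k j - if j ∈ c.2 then 1 else 0 := by
    intro k hk
    rw [Finset.mem_filter, Fintype.mem_piFinset] at hk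
    obtain ⟨I, J, hIJ⟩ := exists_isIsolatingFace Q δ k hk.2
    refine Finset.mem_biUnion.2 ⟨(I, J), Finset.mem_univ _, Finset.mem_image.2 ⟨_,
      Finset.mem_filter.2 ⟨Fintype.mem_piFinset.2 fun j => ?_, hIJ⟩, ?_⟩⟩
    · have := hk.1 j
      rw [Finset.mem_Ico] at this
      rw [Finset.mem_Icc]
      split_ifs <;> omega
    · simp
  refine (Finset.card_le_card hsub).trans (Finset.card_biUnion_le.trans ?_)
  refine (Finset.sum_le_card_nsmul _ _ _ fun c _ => Finset.card_image_le.trans (hF c.1)).trans_eq ?_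
  simp only [Finset.card_univ, Fintype.card_prod, Fintype.card_finset, Fintype.card_fin, smul_eq_mul]
  rw [← mul_pow]
  ring

/-- The determinant of two plane vectors. -/
def planeCross (p q : ℝ × ℝ) : ℝ := p.1 * q.2 - p.2 * q.1

theorem abs_planeCross_le (p q : ℝ × ℝ) : |planeCross p q| ≤ 2 * ‖p‖ * ‖q‖ := by
  have h1 : |p.1| ≤ ‖p‖ := norm_fst_le p
  have h2 : |p.2| ≤ ‖p‖ := norm_snd_le p
  have h3 : |q.1| ≤ ‖q‖ := norm_fst_le q
  have h4 : |q.2| ≤ ‖q‖ := norm_snd_le q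
  calc |planeCross p q| ≤ |p.1 * q.2| + |p.2 * q.1| := abs_sub _ _
    _ = |p.1| * |q.2| + |p.2| * |q.1| := by rw [abs_mul, abs_mul]
    _ ≤ ‖p‖ * ‖q‖ + ‖p‖ * ‖q‖ := by gcongr
    _ = _ := by ring

theorem card_floor_box_le (lo hi : ℝ) (h : lo ≤ hi) :
    ((Finset.Icc ⌊lo⌋ ⌊hi⌋).card : ℝ) ≤ hi - lo + 2 := by
  have h0 := Int.floor_mono h
  have h1 : (((Finset.Icc ⌊lo⌋ ⌊hi⌋).card : ℤ) : ℝ) = ⌊hi⌋ + 1 - ⌊lo⌋ := by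
    rw [Int.card_Icc_of_le _ _ (by omega)]
    push_cast
    ring
  rw [Int.cast_natCast] at h1
  rw [h1]
  linarith [Int.floor_le hi, Int.lt_floor_add_one lo]

theorem card_separated_le_aux {ι : Type*} (P : Finset ι) (x y : ι → ℝ) {σ : ℝ} (hσ : 0 < σ)
    (hsep : ∀ u ∈ P, ∀ v ∈ P, u ≠ v → σ ≤ |x u - x v| ∨ σ ≤ |y u - y v|)
    (x₀ y₀ t r p q : ℝ) (ht : 0 ≤ t) (hr : 0 ≤ r) (hp : |p| = 1) (hq : |q| ≤ 1)
    (hx : ∀ v ∈ P, |x v - x₀| ≤ t)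
    (hstrip : ∀ v ∈ P, |p * (y v - y₀) - q * (x v - x₀)| ≤ r) :
    (P.card : ℝ) ≤ (4 * t / σ + 2) * (4 * r / σ + 2) := by
  classical
  let f : ι → ℝ := fun v => p * (y v - y₀) - q * (x v - x₀)
  have hcard : P.card ≤ ((Finset.Icc ⌊2 * (x₀ - t) / σ⌋ ⌊2 * (x₀ + t) / σ⌋) ×ˢ
      (Finset.Icc ⌊2 * (-r) / σ⌋ ⌊2 * r / σ⌋)).card := by
    refine Finset.card_le_card_of_injOn (fun v => (⌊2 * x v / σ⌋, ⌊2 * f v / σ⌋)) ?_ ?_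
    · intro v hv
      have h1 := abs_le.1 (hx v hv)
      have h2 : -r ≤ f v ∧ f v ≤ r := abs_le.1 (hstrip v hv)
      simp only [Finset.coe_product, Finset.coe_Icc, Set.mem_prod, Set.mem_Icc]
      refine ⟨⟨Int.floor_mono ?_, Int.floor_mono ?_⟩, ⟨Int.floor_mono ?_, Int.floor_mono ?_⟩⟩ <;>
      · gcongr
        linarith
    · intro u hu v hv huv
      by_contra hne
      have h1 := Int.abs_sub_lt_one_of_floor_eq_floor (Prod.ext_iff.1 huv).1
      have h2 := Int.abs_sub_lt_one_of_floor_eq_floor (Prod.ext_iff.1 huv).2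
      rw [← sub_div, abs_div, abs_of_pos hσ, div_lt_one hσ, ← mul_sub, abs_mul, abs_two] at h1 h2
      have h3 : |y u - y v| < σ := by
        have h4 : p * (y u - y v) = (f u - f v) + q * (x u - x v) := by simp only [f]; ring
        calc |y u - y v| = |p * (y u - y v)| := by rw [abs_mul, hp, one_mul]
          _ ≤ |f u - f v| + |q * (x u - x v)| := h4 ▸ abs_add_le _ _
          _ ≤ |f u - f v| + 1 * |x u - x v| := by rw [abs_mul]; gcongr
          _ < σ := by linarith
      rcases hsep u hu v hv hne with h | h
      · linarith [abs_nonneg (x u - x v)]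
      · linarith
  calc (P.card : ℝ) ≤ _ := Nat.cast_le.2 hcard
    _ ≤ (2 * (x₀ + t) / σ - 2 * (x₀ - t) / σ + 2) * (2 * r / σ - 2 * (-r) / σ + 2) := by
      rw [Finset.card_product, Nat.cast_mul]
      gcongr
      · refine add_nonneg (sub_nonneg.2 ?_) zero_le_two
        gcongr; linarith
      · exact card_floor_box_le _ _ (by gcongr; linarith)
      · exact card_floor_box_le _ _ (by gcongr; linarith)
    _ = _ := by ring

/-- The number of `σ`-separated points in the intersection of a square of radius `t` with a strip of
width `r`. -/
theorem card_separated_strip_le {ι : Type*} (P : Finset ι) (w : ι → ℝ × ℝ) {σ : ℝ} (hσ : 0 < σ)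
    (hsep : ∀ u ∈ P, ∀ v ∈ P, u ≠ v → σ ≤ ‖w u - w v‖) (w₀ d : ℝ × ℝ) (hd : d ≠ 0) {t r : ℝ}
    (ht : 0 ≤ t) (hr : 0 ≤ r) (hw : ∀ v ∈ P, ‖w v - w₀‖ ≤ t)
    (hstrip : ∀ v ∈ P, |planeCross d (w v - w₀)| ≤ r * ‖d‖) :
    (P.card : ℝ) ≤ (4 * t / σ + 2) * (4 * r / σ + 2) := by
  have hd0 : 0 < ‖d‖ := norm_pos_iff.2 hd
  have hsep' : ∀ u ∈ P, ∀ v ∈ P, u ≠ v →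
      σ ≤ |(w u).1 - (w v).1| ∨ σ ≤ |(w u).2 - (w v).2| := fun u hu v hv h =>
    le_max_iff.1 (hsep u hu v hv h)
  have h1 : ‖d.1 / ‖d‖‖ ≤ 1 := by
    rw [norm_div, norm_norm, div_le_one hd0]; exact norm_fst_le d
  have h2 : ‖d.2 / ‖d‖‖ ≤ 1 := by
    rw [norm_div, norm_norm, div_le_one hd0]; exact norm_snd_le d
  have hs : ∀ v ∈ P, |d.1 / ‖d‖ * ((w v).2 - w₀.2) - d.2 / ‖d‖ * ((w v).1 - w₀.1)| ≤ r := by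
    intro v hv
    have : d.1 / ‖d‖ * ((w v).2 - w₀.2) - d.2 / ‖d‖ * ((w v).1 - w₀.1) =
        planeCross d (w v - w₀) / ‖d‖ := by
      simp only [planeCross, Prod.fst_sub, Prod.snd_sub]; ring
    rw [this, abs_div, abs_norm, div_le_iff₀ hd0]
    exact hstrip v hv
  rcases max_choice ‖d.1‖ ‖d.2‖ with h | h
  · have h3 : |d.1 / ‖d‖| = 1 := by
      rw [abs_div, abs_norm, div_eq_one_iff_eq hd0.ne']
      exact h.symm
    exact card_separated_le_aux P _ _ hσ hsep' w₀.1 w₀.2 t r _ _ ht hr h3 h2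
      (fun v hv => (norm_fst_le _).trans (hw v hv)) hs
  · have h3 : |d.2 / ‖d‖| = 1 := by
      rw [abs_div, abs_norm, div_eq_one_iff_eq hd0.ne']
      exact h.symm
    refine card_separated_le_aux P _ _ hσ (fun u hu v hv h => (hsep' u hu v hv h).symm)
      w₀.2 w₀.1 t r _ _ ht hr h3 h1 (fun v hv => (norm_snd_le _).trans (hw v hv)) fun v hv => ?_
    rw [abs_sub_comm]
    exact hs v hv

theorem sum_inv_le_of_dyadic {ι : Type*} (P : Finset ι) (τ : ι → ℝ) {σ B : ℝ} (hσ : 0 < σ) (J : ℕ)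
    (hlo : ∀ x ∈ P, σ ≤ τ x) (hhi : ∀ x ∈ P, τ x < 2 ^ J * σ)
    (hB : ∀ j < J, ((P.filter fun x => 2 ^ j * σ ≤ τ x ∧ τ x < 2 * (2 ^ j * σ)).card : ℝ) ≤
      B * (2 ^ j * σ)) :
    ∑ x ∈ P, 1 / τ x ≤ J * B := by
  classical
  have hex : ∀ x ∈ P, ∃ j ∈ Finset.range J, 2 ^ j * σ ≤ τ x ∧ τ x < 2 * (2 ^ j * σ) := by
    intro x hx
    have h1 : ∃ j, τ x < 2 ^ j * σ := ⟨J, hhi x hx⟩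
    have h2 := Nat.find_spec h1
    have h3 : Nat.find h1 ≠ 0 := by
      intro h
      rw [h] at h2
      linarith [hlo x hx]
    obtain ⟨j, hj⟩ := Nat.exists_eq_succ_of_ne_zero h3
    have h4 : Nat.find h1 ≤ J := Nat.find_min' h1 (hhi x hx)
    have h5 := Nat.find_min h1 (m := j) (by omega)
    rw [hj, Nat.succ_eq_add_one, pow_succ] at h2
    exact ⟨j, Finset.mem_range.2 (by omega), not_lt.1 h5, by linarith⟩
  choose! g hgJ hg using hex
  rw [← Finset.sum_fiberwise_of_maps_to hgJ]
  calc ∑ j ∈ Finset.range J, ∑ x ∈ P with g x = j, 1 / τ x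
      ≤ ∑ _j ∈ Finset.range J, B := by
        refine Finset.sum_le_sum fun j hj => ?_
        have hjpos : 0 < 2 ^ j * σ := by positivity
        have hsub : (P.filter fun x => g x = j) ⊆
            P.filter fun x => 2 ^ j * σ ≤ τ x ∧ τ x < 2 * (2 ^ j * σ) := by
          intro x hx
          obtain ⟨hxP, rfl⟩ := Finset.mem_filter.1 hx
          exact Finset.mem_filter.2 ⟨hxP, hg x hxP⟩
        calc ∑ x ∈ P with g x = j, 1 / τ x ≤ ∑ x ∈ P with g x = j, 1 / (2 ^ j * σ) :=
              Finset.sum_le_sum fun x hx =>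
                one_div_le_one_div_of_le hjpos (Finset.mem_filter.1 (hsub hx)).2.1
          _ = (P.filter fun x => g x = j).card * (1 / (2 ^ j * σ)) := by
              rw [Finset.sum_const, nsmul_eq_mul]
          _ ≤ B * (2 ^ j * σ) * (1 / (2 ^ j * σ)) := by
              gcongr
              exact (Nat.cast_le.2 (Finset.card_le_card hsub)).trans (hB j (Finset.mem_range.1 hj))
          _ = B := by field_simp
    _ = J * B := by simp

/-- Córdoba's `L²` argument. -/
theorem card_mul_sq_le_of_sum_inter_le {ι α : Type*} [DecidableEq α] (H : Finset ι)
    (S : ι → Finset α) (W : Finset α) (hS : ∀ v ∈ H, S v ⊆ W) {c b : ℝ} (hc : 0 ≤ c) (hb₀ : 0 ≤ b)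
    (hcard : ∀ v ∈ H, c ≤ (S v).card) (hb : ∀ v ∈ H, ∑ u ∈ H, ((S v ∩ S u).card : ℝ) ≤ b) :
    H.card * c ^ 2 ≤ W.card * b := by
  obtain rfl | hne := H.eq_empty_or_nonempty
  · simp only [Finset.card_empty, Nat.cast_zero, zero_mul]
    positivity
  let μ : α → ℝ := fun k => ∑ v ∈ H, if k ∈ S v then 1 else 0
  have h1 : ∑ k ∈ W, μ k = ∑ v ∈ H, ((S v).card : ℝ) := by
    simp only [μ]
    rw [Finset.sum_comm]
    refine Finset.sum_congr rfl fun v hv => ?_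
    rw [Finset.sum_boole, Finset.filter_mem_eq_inter, Finset.inter_eq_right.2 (hS v hv)]
  have h2 : ∑ k ∈ W, μ k ^ 2 = ∑ v ∈ H, ∑ u ∈ H, ((S v ∩ S u).card : ℝ) := by
    simp only [μ, sq, Finset.sum_mul_sum]
    rw [Finset.sum_comm]
    refine Finset.sum_congr rfl fun v hv => ?_
    rw [Finset.sum_comm]
    refine Finset.sum_congr rfl fun u _ => ?_
    simp only [← ite_and, mul_ite, mul_one, mul_zero]
    rw [Finset.sum_boole]
    congr 2
    ext k
    simp only [Finset.mem_filter, Finset.mem_inter]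
    have := @hS v hv k
    tauto
  have h3 : (H.card : ℝ) * c ≤ ∑ k ∈ W, μ k := by
    rw [h1, ← nsmul_eq_mul]
    exact Finset.card_nsmul_le_sum _ _ _ hcard
  have h4 : ∑ k ∈ W, μ k ^ 2 ≤ H.card * b := by
    rw [h2, ← nsmul_eq_mul]
    exact Finset.sum_le_card_nsmul _ _ _ hb
  have h5 : ((H.card : ℝ) * c) ^ 2 ≤ W.card * (H.card * b) :=
    calc _ ≤ (∑ k ∈ W, μ k) ^ 2 := by gcongr
      _ ≤ W.card * ∑ k ∈ W, μ k ^ 2 := sq_sum_le_card_mul_sum_sq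
      _ ≤ _ := by gcongr
  have h6 : (0 : ℝ) < H.card := by exact_mod_cast hne.card_pos
  refine le_of_mul_le_mul_left ?_ h6
  linarith

/-- Finitely many lines in `ℝ³`, transversal to the horizontal planes and with separated directions,
together with a finite set `Z` of unit cells and many cells of `Z` near each of the lines. The cell
`k` sits at the integer point `(X k, Y k, T k)`, and `G` measures how much `Z` is concentrated. -/
structure TubeFamily (ι α : Type*) where
  N : ℕ
  κ : ℝ
  c : ℝ
  G : ℝ
  slope : ι → ℝ × ℝ
  base : ι → ℝ × ℝ
  X : α → ℤ
  Y : α → ℤ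
  T : α → ℤ
  Z : Finset α
  S : ι → Finset α
  N_pos : 0 < N
  one_le_κ : 1 ≤ κ
  c_pos : 0 < c
  c_le_one : c ≤ 1
  one_le_G : 1 ≤ G
  inj : ∀ k l, X k = X l → Y k = Y l → T k = T l → k = l
  norm_slope_le : ∀ v, ‖slope v‖ ≤ 2
  separated : ∀ u v, u ≠ v → 1 / (κ * N) ≤ ‖slope u - slope v‖
  subset : ∀ v, S v ⊆ Z
  T_nonneg : ∀ k ∈ Z, 0 ≤ T k
  T_lt : ∀ k ∈ Z, T k < N
  near : ∀ v, ∀ k ∈ S v, ‖((X k : ℝ), (Y k : ℝ)) - base v - (T k : ℝ) • slope v‖ ≤ 3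
  le_card : ∀ v, c * N ≤ (S v).card
  card_le : (Z.card : ℝ) ≤ G * N ^ 2
  card_block_le : ∀ m : ℕ, 0 < m → ∀ a b h : ℤ,
    ((Z.filter fun k => X k ∈ Finset.Ico a (a + m) ∧ Y k ∈ Finset.Ico b (b + m) ∧
      T k ∈ Finset.Ico h (h + m)).card : ℝ) ≤ G * m ^ 2

namespace TubeFamily

variable {ι α : Type*} (F : TubeFamily ι α)

/-- The horizontal displacement of a cell from a line. -/
def off (v : ι) (k : α) : ℝ × ℝ :=
  ((F.X k : ℝ), (F.Y k : ℝ)) - F.base v - (F.T k : ℝ) • F.slope v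

/-- The distance between the slopes of two lines. -/
def gap (u v : ι) : ℝ := ‖F.slope u - F.slope v‖

theorem N_pos' : (0 : ℝ) < F.N := Nat.cast_pos.2 F.N_pos

theorem κ_pos : 0 < F.κ := zero_lt_one.trans_le F.one_le_κ

theorem G_pos : 0 < F.G := zero_lt_one.trans_le F.one_le_G

theorem gap_comm (u v : ι) : F.gap u v = F.gap v u := norm_sub_rev _ _

theorem gap_le (u v : ι) : F.gap u v ≤ 4 :=
  (norm_sub_le _ _).trans (by linarith [F.norm_slope_le u, F.norm_slope_le v])

theorem le_gap {u v : ι} (h : u ≠ v) : 1 / (F.κ * F.N) ≤ F.gap u v := F.separated u v h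

theorem gap_pos {u v : ι} (h : u ≠ v) : 0 < F.gap u v :=
  lt_of_lt_of_le (by have := F.N_pos'; have := F.κ_pos; positivity) (F.le_gap h)

theorem norm_off_le {v : ι} {k : α} (hk : k ∈ F.S v) : ‖F.off v k‖ ≤ 3 := F.near v k hk

theorem off_sub_smul (u v : ι) (k l : α) :
    F.off v k - ((F.T k : ℝ) - F.T l) • (F.slope u - F.slope v) =
      F.off u k + F.off v l - F.off u l := by
  simp only [off]
  module

theorem abs_T_sub_mul_gap_le (u v : ι) (k l : α) :
    |(F.T k : ℝ) - F.T l| * F.gap u v ≤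
      ‖F.off v k‖ + ‖F.off v l‖ + ‖F.off u k‖ + ‖F.off u l‖ := by
  have h : ((F.T k : ℝ) - F.T l) • (F.slope u - F.slope v) =
      F.off v k - F.off v l - F.off u k + F.off u l := by
    simp only [off]
    module
  rw [gap, ← Real.norm_eq_abs, ← norm_smul, h]
  calc _ ≤ ‖F.off v k - F.off v l - F.off u k‖ + ‖F.off u l‖ := norm_add_le _ _
    _ ≤ ‖F.off v k - F.off v l‖ + ‖F.off u k‖ + ‖F.off u l‖ := by gcongr; exact norm_sub_le _ _
    _ ≤ _ := by gcongr; exact norm_sub_le _ _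

theorem card_le_of_abs_T_sub_le (v : ι) (R : Finset α) (hR : R ⊆ F.S v) {ℓ : ℝ} (hℓ : 0 ≤ ℓ)
    (h : ∀ k ∈ R, ∀ l ∈ R, |(F.T k : ℝ) - F.T l| ≤ ℓ) : (R.card : ℝ) ≤ 49 * (ℓ + 1) := by
  classical
  obtain rfl | hne := R.eq_empty_or_nonempty
  · simp only [Finset.card_empty, Nat.cast_zero]
    positivity
  obtain ⟨k₀, hk₀, hmin⟩ := R.exists_min_image F.T hne
  let z : ℤ → ℝ × ℝ := fun t => F.base v + (t : ℝ) • F.slope v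
  have hz : ∀ k ∈ R, |(F.X k : ℝ) - (z (F.T k)).1| ≤ 3 ∧ |(F.Y k : ℝ) - (z (F.T k)).2| ≤ 3 := by
    intro k hk
    have h1 := F.norm_off_le (hR hk)
    have h2 := (norm_fst_le _).trans h1
    have h3 := (norm_snd_le _).trans h1
    simp only [off, Prod.fst_sub, Prod.snd_sub, Real.norm_eq_abs, sub_sub] at h2 h3
    exact ⟨h2, h3⟩
  have key : ∀ (x : ℤ) (y : ℝ), |(x : ℝ) - y| ≤ 3 → x - ⌊y⌋ ∈ Finset.Icc (-3 : ℤ) 3 := by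
    intro x y hxy
    obtain ⟨h1, h2⟩ := abs_le.1 hxy
    have h3 : (x : ℝ) < ⌊y⌋ + 4 := by linarith [Int.lt_floor_add_one y]
    have h4 : (⌊y⌋ : ℝ) ≤ x + 3 := by linarith [Int.floor_le y]
    norm_cast at h3 h4
    rw [Finset.mem_Icc]
    omega
  have hcard : R.card ≤ ((Finset.Icc (-3 : ℤ) 3 ×ˢ Finset.Icc (-3 : ℤ) 3) ×ˢ
      Finset.range (⌊ℓ⌋₊ + 1)).card := by
    refine Finset.card_le_card_of_injOn (fun k => ((F.X k - ⌊(z (F.T k)).1⌋,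
      F.Y k - ⌊(z (F.T k)).2⌋), (F.T k - F.T k₀).toNat)) ?_ ?_
    · intro k hk
      have h1 : (((F.T k - F.T k₀).toNat : ℤ) : ℝ) ≤ ℓ := by
        rw [Int.toNat_of_nonneg (sub_nonneg.2 (hmin k hk))]
        push_cast
        exact (le_abs_self _).trans (h k hk k₀ hk₀)
      have h2 := Nat.le_floor (Int.cast_natCast (R := ℝ) _ ▸ h1)
      simp only [Finset.coe_product, Set.mem_prod, Finset.mem_coe, Finset.mem_range]
      exact ⟨⟨key _ _ (hz k hk).1, key _ _ (hz k hk).2⟩, by omega⟩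
    · intro k hk l hl hkl
      obtain ⟨⟨h1, h2⟩, h3⟩ := by simpa only [Prod.mk.injEq] using hkl
      have hT : F.T k = F.T l := by have := hmin k hk; have := hmin l hl; omega
      rw [hT] at h1 h2
      exact F.inj k l (by omega) (by omega) hT
  calc (R.card : ℝ) ≤ _ := Nat.cast_le.2 hcard
    _ = 49 * (⌊ℓ⌋₊ + 1) := by
      rw [Finset.card_product, Finset.card_product, Finset.card_range,
        show (Finset.Icc (-3 : ℤ) 3).card = 7 from rfl]
      push_cast
      ring
    _ ≤ _ := by gcongr; exact Nat.floor_le hℓ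

theorem abs_T_sub_le {k l : α} (hk : k ∈ F.Z) (hl : l ∈ F.Z) :
    |(F.T k : ℝ) - F.T l| ≤ F.N := by
  have h1 : |F.T k - F.T l| ≤ F.N := by
    have := F.T_nonneg k hk; have := F.T_nonneg l hl
    have := F.T_lt k hk; have := F.T_lt l hl
    rw [abs_le]
    omega
  exact_mod_cast h1

theorem card_S_le (v : ι) : ((F.S v).card : ℝ) ≤ 98 * F.N := by
  have h1 : (1 : ℝ) ≤ F.N := Nat.one_le_cast.2 F.N_pos
  refine (F.card_le_of_abs_T_sub_le v _ subset_rfl F.N_pos'.le fun k hk l hl =>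
    F.abs_T_sub_le (F.subset v hk) (F.subset v hl)).trans ?_
  linarith

theorem card_inter_le [DecidableEq α] {u v : ι} (h : 0 < F.gap u v) :
    ((F.S v ∩ F.S u).card : ℝ) ≤ 784 * (1 / F.gap u v) := by
  have h1 := F.card_le_of_abs_T_sub_le v (F.S v ∩ F.S u) Finset.inter_subset_left
    (ℓ := 12 / F.gap u v) (by positivity) fun k hk l hl => by
      rw [le_div_iff₀ h]
      rw [Finset.mem_inter] at hk hl
      linarith [F.abs_T_sub_mul_gap_le u v k l, F.norm_off_le hk.1, F.norm_off_le hk.2,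
        F.norm_off_le hl.1, F.norm_off_le hl.2]
  have h2 : 1 ≤ 4 / F.gap u v := (one_le_div h).2 (F.gap_le u v)
  calc _ ≤ _ := h1
    _ ≤ 49 * (12 / F.gap u v + 4 / F.gap u v) := by gcongr
    _ = _ := by ring

theorem card_tube_le (v : ι) (R : Finset α) (hR : R ⊆ F.Z) {m : ℕ} (hm : 0 < m) (hmN : m ≤ 5 * F.N)
    (h : ∀ k ∈ R, ‖F.off v k‖ ≤ 3 * m) : (R.card : ℝ) ≤ 864 * F.G * F.N * m := by
  classical
  have hm' : (0 : ℝ) < m := Nat.cast_pos.2 hm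
  have hmaps : ∀ k ∈ R, F.T k / m ∈ Finset.Icc (0 : ℤ) (F.N / m) := by
    intro k hk
    have h1 := F.T_nonneg k (hR hk)
    have h2 := F.T_lt k (hR hk)
    exact Finset.mem_Icc.2 ⟨Int.ediv_nonneg h1 (by positivity),
      Int.ediv_le_ediv (by exact_mod_cast hm) h2.le⟩
  have hfib : ∀ j : ℤ, ((R.filter fun k => F.T k / m = j).card : ℝ) ≤ F.G * (12 * m) ^ 2 := by
    intro j
    let z : ℝ × ℝ := F.base v + ((j * m : ℤ) : ℝ) • F.slope v
    have hb := F.card_block_le (12 * m) (by positivity) (⌊z.1⌋ - 5 * m) (⌊z.2⌋ - 5 * m) (j * m)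
    push_cast at hb
    refine le_trans (Nat.cast_le.2 (Finset.card_le_card ?_)) hb
    intro k hk
    obtain ⟨hkR, hkj⟩ := Finset.mem_filter.1 hk
    have hmz : (0 : ℤ) < m := by exact_mod_cast hm
    have hT1 : j * m ≤ F.T k := by rw [← hkj]; exact Int.ediv_mul_le _ hmz.ne'
    have hT2 : F.T k < j * m + m := by
      have := Int.lt_ediv_add_one_mul_self (F.T k) hmz
      rw [hkj] at this
      linarith
    have hT1' : ((j * m : ℤ) : ℝ) ≤ F.T k := by exact_mod_cast hT1
    have hT2' : (F.T k : ℝ) ≤ ((j * m : ℤ) : ℝ) + m := by exact_mod_cast hT2.le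
    have hd : ‖((F.X k : ℝ), (F.Y k : ℝ)) - z‖ ≤ 5 * m := by
      have : ((F.X k : ℝ), (F.Y k : ℝ)) - z =
          F.off v k + ((F.T k : ℝ) - ((j * m : ℤ) : ℝ)) • F.slope v := by
        simp only [off, z]
        module
      rw [this]
      calc _ ≤ ‖F.off v k‖ + ‖((F.T k : ℝ) - ((j * m : ℤ) : ℝ)) • F.slope v‖ := norm_add_le _ _
        _ ≤ 3 * m + m * 2 := by
          rw [norm_smul, Real.norm_eq_abs, abs_of_nonneg (by linarith)]
          gcongr
          · exact h k hkR
          · linarith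
          · exact F.norm_slope_le v
        _ = _ := by ring
    have key : ∀ (x : ℤ) (y : ℝ), |(x : ℝ) - y| ≤ 5 * m →
        x ∈ Finset.Ico (⌊y⌋ - 5 * (m : ℤ)) (⌊y⌋ - 5 * (m : ℤ) + 12 * m) := by
      intro x y hxy
      obtain ⟨h1, h2⟩ := abs_le.1 hxy
      have h3 : (x : ℝ) < ⌊y⌋ + 1 + 5 * m := by linarith [Int.lt_floor_add_one y]
      have h4 : (⌊y⌋ : ℝ) ≤ x + 5 * m := by linarith [Int.floor_le y]
      norm_cast at h3 h4
      push_cast at h3 h4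
      rw [Finset.mem_Ico]
      omega
    refine Finset.mem_filter.2 ⟨hR hkR, ?_⟩
    exact ⟨key _ _ ((norm_fst_le _).trans hd), key _ _ ((norm_snd_le _).trans hd),
      Finset.mem_Ico.2 ⟨hT1, by linarith⟩⟩
  have hj : ((Finset.Icc (0 : ℤ) (F.N / m)).card : ℝ) ≤ 6 * F.N / m := by
    rw [Int.card_Icc, sub_zero, ← Int.natCast_div, Int.toNat_natCast_add_one]
    have h1 : ((F.N / m : ℕ) : ℝ) ≤ F.N / m := Nat.cast_div_le
    have h2 : (1 : ℝ) ≤ 5 * F.N / m := (one_le_div hm').2 (by exact_mod_cast hmN)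
    push_cast
    calc ((F.N / m : ℕ) : ℝ) + 1 ≤ F.N / m + 5 * F.N / m := add_le_add h1 h2
      _ = _ := by ring
  rw [Finset.card_eq_sum_card_fiberwise hmaps, Nat.cast_sum]
  calc _ ≤ ∑ _j ∈ Finset.Icc (0 : ℤ) (F.N / m), F.G * (12 * m) ^ 2 :=
        Finset.sum_le_sum fun j _ => hfib j
    _ = (Finset.Icc (0 : ℤ) (F.N / m)).card * (F.G * (12 * m) ^ 2) := by
        rw [Finset.sum_const, nsmul_eq_mul]
    _ ≤ 6 * F.N / m * (F.G * (12 * m) ^ 2) := by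
        have := F.G_pos
        gcongr
    _ = _ := by field_simp; ring

end TubeFamily

theorem abs_planeCross_mul_norm_le {a d d' : ℝ × ℝ} {s s' : ℝ} (ha : 18 ≤ ‖a‖)
    (h : ‖a - s • d‖ ≤ 9) (h' : ‖a - s' • d'‖ ≤ 9) :
    |planeCross d d'| * ‖a‖ ≤ 180 * ‖d‖ * ‖d'‖ := by
  have e1 : ‖a‖ ≤ 2 * (|s| * ‖d‖) := by
    have := norm_sub_norm_le a (s • d)
    rw [norm_smul, Real.norm_eq_abs] at this
    linarith
  have e2 : ‖a‖ ≤ 2 * (|s'| * ‖d'‖) := by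
    have := norm_sub_norm_le a (s' • d')
    rw [norm_smul, Real.norm_eq_abs] at this
    linarith
  have e3 : ‖s' • d'‖ ≤ 3 / 2 * ‖a‖ := by
    have := norm_sub_norm_le (s' • d') a
    rw [norm_sub_rev] at this
    linarith
  have e4 : |s| * |s'| * |planeCross d d'| ≤ 45 * ‖a‖ := by
    have : s * s' * planeCross d d' =
        planeCross a (a - s' • d') * (-1) - planeCross (a - s • d) (s' • d') := by
      simp only [planeCross, Prod.fst_sub, Prod.snd_sub, Prod.smul_fst, Prod.smul_snd, smul_eq_mul]
      ring
    rw [← abs_mul, ← abs_mul, this]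
    calc _ ≤ |planeCross a (a - s' • d') * (-1)| + |planeCross (a - s • d) (s' • d')| := abs_sub _ _
      _ ≤ 2 * ‖a‖ * 9 + 2 * 9 * (3 / 2 * ‖a‖) := by
        rw [abs_mul, abs_neg, abs_one, mul_one]
        refine add_le_add ((abs_planeCross_le _ _).trans ?_) ((abs_planeCross_le _ _).trans ?_) <;>
        gcongr
      _ = _ := by ring
  have ha0 : 0 < ‖a‖ := by linarith
  refine le_of_mul_le_mul_right ?_ ha0
  calc |planeCross d d'| * ‖a‖ * ‖a‖ ≤
      |planeCross d d'| * (2 * (|s| * ‖d‖)) * (2 * (|s'| * ‖d'‖)) := by gcongr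
    _ = 4 * ‖d‖ * ‖d'‖ * (|s| * |s'| * |planeCross d d'|) := by ring
    _ ≤ 4 * ‖d‖ * ‖d'‖ * (45 * ‖a‖) := by gcongr
    _ = _ := by ring

namespace TubeFamily

variable {ι α : Type*} (F : TubeFamily ι α)

theorem card_gap_lt_le (v : ι) (P : Finset ι) {t : ℝ} (ht : 0 ≤ t) (h : ∀ u ∈ P, F.gap v u ≤ t) :
    (P.card : ℝ) ≤ (4 * t * (F.κ * F.N) + 2) * (8 * t * (F.κ * F.N) + 2) := by
  have h0 : 0 < F.κ * F.N := mul_pos F.κ_pos F.N_pos'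
  have h1 := card_separated_strip_le P F.slope (one_div_pos.2 h0)
    (fun u _ w _ huw => F.separated u w huw) (F.slope v) (1, 0) (by simp) (t := t) (r := 2 * t) ht
    (by positivity) (fun u hu => by rw [norm_sub_rev]; exact h u hu) fun u hu => by
      refine (abs_planeCross_le _ _).trans ?_
      have := h u hu
      rw [gap, norm_sub_rev] at this
      nlinarith [norm_nonneg ((1, 0) : ℝ × ℝ)]
  refine h1.trans (le_of_eq ?_)
  field_simp
  ring

/-- The constant appearing in the overlap bound for a hairbrush. -/
noncomputable def overlapConst : ℝ := 98 + 7840 * (1440000 * F.κ / F.c + 2) * F.κ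

theorem overlapConst_pos : 0 < F.overlapConst := by
  have := F.κ_pos
  have := F.c_pos
  unfold overlapConst
  positivity

/-- In a hairbrush with stem `v`, the parts of the bristles far from the stem overlap little. -/
theorem sum_card_far_inter_le [DecidableEq ι] [DecidableEq α] {J : ℕ} (hJ : 1 ≤ J)
    (hJ' : 4 * F.κ * F.N < 2 ^ J) {θ : ℝ} (hθ : 18000 / F.c / F.N ≤ θ) (v : ι) (H : Finset ι)
    (hH : ∀ u ∈ H, F.gap v u < 2 * θ) (hHv : ∀ u ∈ H, (F.S v ∩ F.S u).Nonempty)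
    (S' : ι → Finset α) (hS' : ∀ u, S' u ⊆ F.S u)
    (hfar : ∀ u, ∀ k ∈ S' u, F.c / 1000 * θ * F.N ≤ ‖F.off v k‖) {u : ι} (hu : u ∈ H)
    (huv : u ≠ v) :
    ∑ w ∈ H, ((S' u ∩ S' w).card : ℝ) ≤ F.overlapConst * J * F.N := by
  have hN := F.N_pos'
  have hc := F.c_pos
  have hκ := F.κ_pos
  have hθ0 : 0 < θ := lt_of_lt_of_le (by positivity) hθ
  have hfar0 : 18 ≤ F.c / 1000 * θ * F.N := by
    rw [div_div, div_le_iff₀ (by positivity)] at hθ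
    linarith
  have hσ : 0 < 1 / (F.κ * F.N) := by positivity
  let P := (H.erase u).filter fun w => (S' u ∩ S' w).Nonempty
  have hPne : ∀ w ∈ P, w ≠ u := fun w hw => Finset.ne_of_mem_erase (Finset.mem_filter.1 hw).1
  have hdisp : ∀ w ∈ H, ∀ k ∈ S' w, ∃ s : ℝ, ‖F.off v k - s • (F.slope w - F.slope v)‖ ≤ 9 := by
    intro w hw k hk
    obtain ⟨l, hl⟩ := hHv w hw
    rw [Finset.mem_inter] at hl
    refine ⟨(F.T k : ℝ) - F.T l, ?_⟩
    rw [F.off_sub_smul]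
    calc _ ≤ ‖F.off w k + F.off v l‖ + ‖F.off w l‖ := norm_sub_le _ _
      _ ≤ ‖F.off w k‖ + ‖F.off v l‖ + ‖F.off w l‖ := by gcongr; exact norm_add_le _ _
      _ ≤ 3 + 3 + 3 := by
        gcongr
        exacts [F.norm_off_le (hS' w hk), F.norm_off_le hl.1, F.norm_off_le hl.2]
      _ = 9 := by norm_num
  have hcross : ∀ w ∈ P, |planeCross (F.slope u - F.slope v) (F.slope w - F.slope u)| ≤
      360000 / (F.c * F.N) * ‖F.slope u - F.slope v‖ := by
    intro w hw
    obtain ⟨hwH, k, hk⟩ := Finset.mem_filter.1 hw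
    have hwH := Finset.mem_of_mem_erase hwH
    rw [Finset.mem_inter] at hk
    obtain ⟨s, hs⟩ := hdisp u hu k hk.1
    obtain ⟨s', hs'⟩ := hdisp w hwH k hk.2
    have hfk := hfar u k hk.1
    have h1 := abs_planeCross_mul_norm_le (hfar0.trans hfk) hs hs'
    have h2 : planeCross (F.slope u - F.slope v) (F.slope w - F.slope u) =
        planeCross (F.slope u - F.slope v) (F.slope w - F.slope v) := by
      simp only [planeCross, Prod.fst_sub, Prod.snd_sub]
      ring
    have h3 : ‖F.slope w - F.slope v‖ ≤ 2 * θ := by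
      rw [norm_sub_rev]
      exact (hH w hwH).le
    rw [h2]
    have h4 : 0 < F.c / 1000 * θ * F.N := by positivity
    refine le_of_mul_le_mul_right ?_ h4
    calc _ ≤ |planeCross (F.slope u - F.slope v) (F.slope w - F.slope v)| * ‖F.off v k‖ := by gcongr
      _ ≤ 180 * ‖F.slope u - F.slope v‖ * (2 * θ) := h1.trans (by gcongr)
      _ = _ := by field_simp; ring
  have hsum : ∑ w ∈ P, 1 / F.gap u w ≤
      J * (10 * (1440000 * F.κ / F.c + 2) * (F.κ * F.N)) := by
    refine sum_inv_le_of_dyadic P _ hσ J (fun w hw => F.le_gap (hPne w hw).symm) (fun w _ => ?_)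
      fun j _ => ?_
    · refine (F.gap_le u w).trans_lt ?_
      rw [mul_one_div, lt_div_iff₀ (by positivity)]
      linarith
    · have hj : (1 : ℝ) ≤ 2 ^ j := one_le_pow₀ one_le_two
      have h1 := card_separated_strip_le
        (P.filter fun w => 2 ^ j * (1 / (F.κ * F.N)) ≤ F.gap u w ∧
          F.gap u w < 2 * (2 ^ j * (1 / (F.κ * F.N)))) F.slope hσ
        (fun w _ w' _ h => F.separated w w' h) (F.slope u) (F.slope u - F.slope v)
        (norm_pos_iff.1 (F.gap_pos huv)) (t := 2 * (2 ^ j * (1 / (F.κ * F.N))))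
        (r := 360000 / (F.c * F.N)) (by positivity) (by positivity)
        (fun w hw => by rw [norm_sub_rev]; exact (Finset.mem_filter.1 hw).2.2.le)
        (fun w hw => hcross w (Finset.mem_filter.1 hw).1)
      refine h1.trans ?_
      have e1 : 4 * (2 * (2 ^ j * (1 / (F.κ * F.N)))) / (1 / (F.κ * F.N)) + 2 = 8 * 2 ^ j + 2 := by
        field_simp
        ring
      have e2 : 4 * (360000 / (F.c * F.N)) / (1 / (F.κ * F.N)) + 2 = 1440000 * F.κ / F.c + 2 := by
        field_simp
        ring
      have e3 : 10 * (1440000 * F.κ / F.c + 2) * (F.κ * F.N) * (2 ^ j * (1 / (F.κ * F.N))) =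
          10 * 2 ^ j * (1440000 * F.κ / F.c + 2) := by
        field_simp
      rw [e1, e2, e3]
      gcongr
      linarith
  have hJr : (1 : ℝ) ≤ J := Nat.one_le_cast.2 hJ
  rw [← Finset.add_sum_erase H _ hu, Finset.inter_self]
  calc _ ≤ 98 * F.N + ∑ w ∈ P, 784 * (1 / F.gap u w) := by
        refine add_le_add ((Nat.cast_le.2 (Finset.card_le_card (hS' u))).trans (F.card_S_le u)) ?_
        rw [← Finset.sum_filter_of_ne (p := fun w => (S' u ∩ S' w).Nonempty)]
        · refine Finset.sum_le_sum fun w hw => ?_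
          refine (Nat.cast_le.2 (Finset.card_le_card
            (Finset.inter_subset_inter (hS' u) (hS' w)))).trans ?_
          rw [F.gap_comm]
          exact F.card_inter_le (F.gap_pos (hPne w hw))
        · intro w _ hw
          rw [Nat.cast_ne_zero, Finset.card_ne_zero] at hw
          exact hw
    _ ≤ 98 * J * F.N + 784 * (J * (10 * (1440000 * F.κ / F.c + 2) * (F.κ * F.N))) := by
        rw [← Finset.mul_sum]
        gcongr
        linarith
    _ = _ := by rw [overlapConst]; ring

/-- The hairbrush bound: few lines make an angle about `θ` with a given line and meet it. -/
theorem card_hairbrush_le [DecidableEq α] {J : ℕ} (hJ : 1 ≤ J) (hJ' : 4 * F.κ * F.N < 2 ^ J)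
    {θ : ℝ} (hθ : 18000 / F.c / F.N ≤ θ) (v : ι) (H : Finset ι) (hHlo : ∀ u ∈ H, θ ≤ F.gap v u)
    (hHhi : ∀ u ∈ H, F.gap v u < 2 * θ) (hHv : ∀ u ∈ H, (F.S v ∩ F.S u).Nonempty) :
    (H.card : ℝ) ≤ 6912 * F.G * F.overlapConst * J * F.N / F.c ^ 2 * θ := by
  classical
  have hN := F.N_pos'
  have hc := F.c_pos
  have hc1 := F.c_le_one
  have hG := F.G_pos
  have hK := F.overlapConst_pos
  have hθ0 : 0 < θ := lt_of_lt_of_le (by positivity) hθ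
  obtain rfl | ⟨u₀, hu₀⟩ := H.eq_empty_or_nonempty
  · simp only [Finset.card_empty, Nat.cast_zero]
    positivity
  have hθ4 : θ ≤ 4 := (hHlo u₀ hu₀).trans (F.gap_le _ _)
  have hθN : 18000 ≤ F.c * (θ * F.N) := by
    rw [div_div, div_le_iff₀ (by positivity)] at hθ
    linarith
  have hθN' : 18000 ≤ θ * F.N := hθN.trans (mul_le_of_le_one_left (by positivity) hc1)
  let S' : ι → Finset α := fun u => (F.S u).filter fun k => F.c / 1000 * θ * F.N ≤ ‖F.off v k‖
  have hS' : ∀ u, S' u ⊆ F.S u := fun u => Finset.filter_subset _ _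
  have hcard : ∀ u ∈ H, F.c * F.N / 2 ≤ (S' u).card := by
    intro u hu
    have h1 := F.card_le_of_abs_T_sub_le u
      ((F.S u).filter fun k => ¬ F.c / 1000 * θ * F.N ≤ ‖F.off v k‖) (Finset.filter_subset _ _)
      (ℓ := F.c / 500 * F.N + 6 / θ) (by positivity) fun k hk l hl => by
        rw [Finset.mem_filter, not_le] at hk hl
        have h2 := F.abs_T_sub_mul_gap_le u v k l
        have h3 := F.norm_off_le hk.1
        have h4 := F.norm_off_le hl.1
        have h5 := hHlo u hu
        rw [F.gap_comm] at h5
        refine le_of_mul_le_mul_right ?_ hθ0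
        calc |(F.T k : ℝ) - F.T l| * θ ≤ |(F.T k : ℝ) - F.T l| * F.gap u v := by gcongr
          _ ≤ F.c / 500 * F.N * θ + 6 := by linarith
          _ = _ := by field_simp
    have h6 : 6 / θ ≤ 6 / 18000 * (F.c * F.N) := by
      rw [div_le_iff₀ hθ0]
      linarith
    have h7 : 1 ≤ 4 / 18000 * (F.c * F.N) := by nlinarith
    have h8 := Finset.card_filter_add_card_filter_not (s := F.S u)
      (fun k => F.c / 1000 * θ * F.N ≤ ‖F.off v k‖)
    have h9 : ((S' u).card : ℝ) + ((F.S u).filter fun k =>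
        ¬ F.c / 1000 * θ * F.N ≤ ‖F.off v k‖).card = (F.S u).card := by exact_mod_cast h8
    linarith [F.le_card u]
  let m := ⌈θ * F.N⌉₊
  have hm1 : θ * F.N ≤ m := Nat.le_ceil _
  have hm2 : (m : ℝ) < θ * F.N + 1 := Nat.ceil_lt_add_one (by positivity)
  have hm0 : 0 < m := Nat.ceil_pos.2 (by positivity)
  have hmN : m ≤ 5 * F.N := by
    have : (1 : ℝ) ≤ F.N := Nat.one_le_cast.2 F.N_pos
    have : (m : ℝ) ≤ (5 * F.N : ℕ) := by
      push_cast
      nlinarith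
    exact_mod_cast this
  let W := F.Z.filter fun k => ‖F.off v k‖ ≤ 3 * m
  have hW : (W.card : ℝ) ≤ 1728 * F.G * F.N ^ 2 * θ := by
    refine (F.card_tube_le v W (Finset.filter_subset _ _) hm0 hmN
      fun k hk => (Finset.mem_filter.1 hk).2).trans ?_
    calc _ ≤ 864 * F.G * F.N * (2 * (θ * F.N)) := by gcongr; linarith
      _ = _ := by ring
  have hS'W : ∀ u ∈ H, S' u ⊆ W := by
    intro u hu k hk
    have hku := hS' u hk
    refine Finset.mem_filter.2 ⟨F.subset u hku, ?_⟩
    obtain ⟨l, hl⟩ := hHv u hu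
    rw [Finset.mem_inter] at hl
    have h1 := F.off_sub_smul u v k l
    have h2 : F.off v k = F.off u k + F.off v l - F.off u l +
      ((F.T k : ℝ) - F.T l) • (F.slope u - F.slope v) := by rw [← h1]; abel
    have h3 : ‖((F.T k : ℝ) - F.T l) • (F.slope u - F.slope v)‖ ≤ F.N * (2 * θ) := by
      rw [norm_smul, Real.norm_eq_abs]
      gcongr
      · exact F.abs_T_sub_le (F.subset u hku) (F.subset v hl.1)
      · rw [norm_sub_rev]
        exact (hHhi u hu).le
    calc _ ≤ ‖F.off u k‖ + ‖F.off v l‖ + ‖F.off u l‖ + F.N * (2 * θ) := by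
          rw [h2]
          refine (norm_add_le _ _).trans (add_le_add ((norm_sub_le _ _).trans ?_) h3)
          gcongr
          exact norm_add_le _ _
      _ ≤ 3 * m := by linarith [F.norm_off_le hku, F.norm_off_le hl.1, F.norm_off_le hl.2]
  have hmain := card_mul_sq_le_of_sum_inter_le H S' W hS'W (c := F.c * F.N / 2)
    (b := F.overlapConst * J * F.N) (by positivity) (by positivity) hcard fun u hu =>
      F.sum_card_far_inter_le hJ hJ' hθ v H hHhi hHv S' hS'
        (fun w k hk => (Finset.mem_filter.1 hk).2) hu fun huv => by
          have := hHlo u hu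
          rw [huv, gap, sub_self, norm_zero] at this
          linarith
  refine le_of_mul_le_mul_right ?_ (show 0 < (F.c * F.N / 2) ^ 2 by positivity)
  calc _ ≤ 1728 * F.G * F.N ^ 2 * θ * (F.overlapConst * J * F.N) := hmain.trans (by gcongr)
    _ = _ := by field_simp; ring

/-- The constant in `TubeFamily.card_le_const`. -/
noncomputable def boundConst (κ c : ℝ) : ℝ :=
  (98 * ((4 * (18000 / c) * κ + 2) * (8 * (18000 / c) * κ + 2)) +
    784 * (6912 * (98 + 7840 * (1440000 * κ / c + 2) * κ) / c ^ 2)) / c ^ 2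

theorem boundConst_pos {κ c : ℝ} (hκ : 0 < κ) (hc : 0 < c) : 0 < boundConst κ c := by
  unfold boundConst
  positivity

theorem card_le_const [Fintype ι] {J : ℕ} (hJ : 1 ≤ J) (hJ' : 4 * F.κ * F.N < 2 ^ J) :
    (Fintype.card ι : ℝ) ≤ boundConst F.κ F.c * F.G ^ 2 * J ^ 2 * F.N := by
  classical
  have hN := F.N_pos'
  have hc := F.c_pos
  have hc1 := F.c_le_one
  have hG := F.G_pos
  have hG1 := F.one_le_G
  have hκ := F.κ_pos
  have hκ1 := F.one_le_κ
  have hK := F.overlapConst_pos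
  have hJr : (1 : ℝ) ≤ J := Nat.one_le_cast.2 hJ
  set σ := 18000 / F.c / F.N with hσ
  have hσ0 : 0 < σ := by positivity
  set A := (4 * (18000 / F.c) * F.κ + 2) * (8 * (18000 / F.c) * F.κ + 2) with hA
  have hA0 : 0 < A := by positivity
  set B := 6912 * F.G * F.overlapConst * J * F.N / F.c ^ 2 with hB
  have hB0 : 0 < B := by positivity
  have hrow : ∀ v, ∑ u, ((F.S v ∩ F.S u).card : ℝ) ≤ 98 * A * F.N + 784 * (J * B) := by
    intro v
    let P := Finset.univ.filter fun u => ¬ F.gap v u < σ ∧ (F.S v ∩ F.S u).Nonempty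
    have hP : ∀ u ∈ P, σ ≤ F.gap v u ∧ (F.S v ∩ F.S u).Nonempty := fun u hu => by
      rw [← not_lt]
      exact (Finset.mem_filter.1 hu).2
    have hsum : ∑ u ∈ P, 1 / F.gap v u ≤ J * B := by
      refine sum_inv_le_of_dyadic P _ hσ0 J (fun u hu => (hP u hu).1) (fun u _ => ?_) fun j _ => ?_
      · refine (F.gap_le v u).trans_lt ?_
        have h1 : 1 ≤ 18000 / F.c := (one_le_div hc).2 (by linarith)
        rw [hσ, mul_div_assoc', lt_div_iff₀ hN]
        calc 4 * (F.N : ℝ) ≤ 4 * F.κ * F.N := by nlinarith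
          _ < 2 ^ J := hJ'
          _ ≤ _ := le_mul_of_one_le_right (by positivity) h1
      · exact F.card_hairbrush_le hJ hJ' (le_mul_of_one_le_left hσ0.le (one_le_pow₀ one_le_two)) v _
          (fun u hu => (Finset.mem_filter.1 hu).2.1) (fun u hu => (Finset.mem_filter.1 hu).2.2)
          (fun u hu => (hP u (Finset.mem_filter.1 hu).1).2)
    rw [← Finset.sum_filter_add_sum_filter_not Finset.univ (fun u => F.gap v u < σ)]
    refine add_le_add ?_ ?_
    · calc ∑ u with F.gap v u < σ, ((F.S v ∩ F.S u).card : ℝ)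
          ≤ ∑ u with F.gap v u < σ, 98 * (F.N : ℝ) := Finset.sum_le_sum fun u _ =>
            (Nat.cast_le.2 (Finset.card_le_card Finset.inter_subset_left)).trans (F.card_S_le v)
        _ = (Finset.univ.filter fun u => F.gap v u < σ).card * (98 * (F.N : ℝ)) := by
          rw [Finset.sum_const, nsmul_eq_mul]
        _ ≤ A * (98 * (F.N : ℝ)) := by
          gcongr
          refine (F.card_gap_lt_le v _ hσ0.le
            fun u hu => (Finset.mem_filter.1 hu).2.le).trans (le_of_eq ?_)
          rw [hA, hσ]
          field_simp
        _ = _ := by ring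
    · calc ∑ u with ¬ F.gap v u < σ, ((F.S v ∩ F.S u).card : ℝ)
          = ∑ u ∈ P, ((F.S v ∩ F.S u).card : ℝ) := by
            rw [← Finset.sum_filter_of_ne (p := fun u => (F.S v ∩ F.S u).Nonempty),
              Finset.filter_filter]
            intro u _ hu
            rw [Nat.cast_ne_zero, Finset.card_ne_zero] at hu
            exact hu
        _ ≤ ∑ u ∈ P, 784 * (1 / F.gap v u) := Finset.sum_le_sum fun u hu => by
            rw [F.gap_comm]
            refine F.card_inter_le ?_
            rw [F.gap_comm]
            exact hσ0.trans_le (hP u hu).1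
        _ ≤ _ := by
            rw [← Finset.mul_sum]
            gcongr
  have hmain := card_mul_sq_le_of_sum_inter_le Finset.univ F.S F.Z (fun v _ => F.subset v)
    (c := F.c * F.N) (b := 98 * A * F.N + 784 * (J * B)) (by positivity) (by positivity)
    (fun v _ => F.le_card v) fun v _ => hrow v
  rw [Finset.card_univ] at hmain
  refine le_of_mul_le_mul_right ?_ (show 0 < (F.c * F.N) ^ 2 by positivity)
  have hGJ : 1 ≤ F.G * J ^ 2 := one_le_mul_of_one_le_of_one_le hG1 (one_le_pow₀ hJr)
  calc _ ≤ F.G * F.N ^ 2 * (98 * A * F.N + 784 * (J * B)) :=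
        hmain.trans (by gcongr; exact F.card_le)
    _ ≤ F.G * F.N ^ 2 * (98 * A * F.N * (F.G * J ^ 2) + 784 * (J * B)) := by
        gcongr F.G * F.N ^ 2 * (?_ + 784 * (J * B))
        exact le_mul_of_one_le_right (by positivity) hGJ
    _ = _ := by
        rw [hB, boundConst, ← hA, overlapConst]
        field_simp

end TubeFamily

theorem dist_le_of_abs_slope_sub_le {n : Type*} [Fintype n] {u v : EuclideanSpace ℝ n} {i : n}
    (hu : ‖u‖ = 1) (hv : ‖v‖ = 1) (huv : 0 < u i * v i) {η : ℝ} (hη : 0 ≤ η)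
    (h : ∀ j, |u j / u i - v j / v i| ≤ η) :
    dist u v ≤ 2 * (√(Fintype.card n) * η) := by
  have hui : u i ≠ 0 := left_ne_zero_of_mul huv.ne'
  have hvi : v i ≠ 0 := right_ne_zero_of_mul huv.ne'
  have hc : 0 < u i / v i := by
    have := div_pos huv (sq_pos_of_ne_zero hvi)
    rwa [sq, mul_div_mul_right _ _ hvi] at this
  have hcoord : ∀ j, |u j - u i / v i * v j| ≤ η := by
    intro j
    have h1 : u j - u i / v i * v j = u i * (u j / u i - v j / v i) := by
      field_simp
    have h2 : |u i| ≤ 1 := hu ▸ PiLp.norm_apply_le u i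
    rw [h1, abs_mul]
    exact (mul_le_of_le_one_left (abs_nonneg _) h2).trans (h j)
  have h1 : ‖u - (u i / v i) • v‖ ≤ √(Fintype.card n) * η := by
    rw [EuclideanSpace.norm_eq, ← Real.sqrt_sq hη, ← Real.sqrt_mul (Nat.cast_nonneg _)]
    refine Real.sqrt_le_sqrt ?_
    calc _ ≤ ∑ _j : n, η ^ 2 := Finset.sum_le_sum fun j _ => by
          rw [Real.norm_eq_abs]
          exact pow_le_pow_left₀ (abs_nonneg _) (hcoord j) 2
      _ = _ := by rw [Finset.sum_const, Finset.card_univ, nsmul_eq_mul]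
  have h2 : ‖(u i / v i) • v - v‖ ≤ ‖u - (u i / v i) • v‖ := by
    have h3 : (u i / v i) • v - v = (u i / v i - 1) • v := by module
    have h4 := abs_norm_sub_norm_le ((u i / v i) • v) u
    rw [norm_smul, Real.norm_eq_abs, abs_of_pos hc, hv, hu, mul_one, norm_sub_rev] at h4
    rwa [h3, norm_smul, hv, mul_one]
  calc dist u v = ‖(u - (u i / v i) • v) + ((u i / v i) • v - v)‖ := by
        rw [dist_eq_norm]; congr 1; abel
    _ ≤ _ := (norm_add_le _ _).trans (by linarith)

theorem mem_Ico_of_gridCube3_subset {N : ℕ} (hN : 0 < N) {k : Fin 3 → ℤ}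
    (hk : gridCube3 (1 / N) k ⊆ unitCube3) (j : Fin 3) : k j ∈ Finset.Ico (0 : ℤ) N := by
  have hN' : (0 : ℝ) < N := Nat.cast_pos.2 hN
  have h1 : WithLp.toLp 2 (fun j => (k j : ℝ) * (1 / N)) ∈ gridCube3 (1 / N) k := fun j =>
    ⟨le_rfl, mul_le_mul_of_nonneg_right (lt_add_one _).le (by positivity)⟩
  have h2 : WithLp.toLp 2 (fun j => ((k j : ℝ) + 1) * (1 / N)) ∈ gridCube3 (1 / N) k := fun j =>
    ⟨mul_le_mul_of_nonneg_right (lt_add_one _).le (by positivity), le_rfl⟩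
  have h3 : 0 ≤ (k j : ℝ) * (1 / N) := (hk h1 j).1
  have h4 : ((k j : ℝ) + 1) * (1 / N) ≤ 1 := (hk h2 j).2
  rw [mul_one_div] at h3 h4
  have h5 : (0 : ℝ) ≤ k j := by
    have := mul_nonneg h3 hN'.le
    rwa [div_mul_cancel₀ _ hN'.ne'] at this
  rw [div_le_one hN'] at h4
  norm_cast at h4 h5
  rw [Finset.mem_Ico]
  omega

theorem Fin.three_cases (i j : Fin 3) : j = i ∨ j = i + 1 ∨ j = i + 2 := by
  revert i j
  decide

/-- The hairbrush estimate for directions that are uniformly transversal to a coordinate plane. -/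
theorem card_transversal_directions_le {c : ℝ} (hc : 0 < c) (hc1 : c ≤ 1) {N D : ℕ} (hN : 0 < N)
    (hD : 0 < D) {Q : MvPolynomial (Fin 3) ℝ} (hQ : Q ≠ 0) (hQD : Q.totalDegree ≤ D)
    (V : Finset (EuclideanSpace ℝ (Fin 3))) (hV : ∀ v ∈ V, ‖v‖ = 1)
    (hsep : ∀ u ∈ V, ∀ v ∈ V, u ≠ v → (1 : ℝ) / N ≤ dist u v)
    (hline : ∀ v ∈ V, ∃ x : EuclideanSpace ℝ (Fin 3),
      c * (N : ℝ) ≤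
        (Set.ncard {k : Fin 3 → ℤ |
            gridCube3 (1 / N) k ⊆ unitCube3 ∧
            (gridCube3 (1 / N) k ∩ {y | ∃ t : ℝ, y = x + t • v}).Nonempty ∧
            ∃ y ∈ gridCube3 (1 / N) k,
              MvPolynomial.eval (fun i => y i) Q = 0} : ℝ))
    (i : Fin 3) (hi : ∀ v ∈ V, 1 / 2 ≤ |v i|) (hpos : ∀ u ∈ V, ∀ v ∈ V, 0 < u i * v i)
    {J : ℕ} (hJ : 1 ≤ J) (hJ' : 16 * (N : ℝ) < 2 ^ J) :
    (V.card : ℝ) ≤ TubeFamily.boundConst 4 c * (85184 * D) ^ 2 * J ^ 2 * N := by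
  classical
  have hN' : (0 : ℝ) < N := Nat.cast_pos.2 hN
  have hD1 : (1 : ℝ) ≤ D := Nat.one_le_cast.2 hD
  choose! x hx using hline
  let Z : Finset (Fin 3 → ℤ) := (Fintype.piFinset fun _ => Finset.Ico (0 : ℤ) N).filter fun k =>
    ∃ y ∈ gridCube3 (1 / N) k, MvPolynomial.eval (fun i => y i) Q = 0
  let w : EuclideanSpace ℝ (Fin 3) → Fin 3 → ℝ := fun v j => v j / v i
  have hw : ∀ v ∈ V, ∀ j, |w v j| ≤ 2 := by
    intro v hv j
    have h1 : |v j| ≤ 1 := hV v hv ▸ PiLp.norm_apply_le v j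
    have h2 := hi v hv
    rw [abs_div, div_le_iff₀ (by linarith)]
    linarith
  have hbox : ∀ (m : ℕ), 0 < m → ∀ b : Fin 3 → ℤ,
      ((Z.filter fun k => ∀ j, k j ∈ Finset.Ico (b j) (b j + m)).card : ℝ) ≤
        85184 * D * m ^ 2 := by
    intro m hm b
    have h1 := card_gridCubes_zero_le (by norm_num) Q hQ D hD hQD (one_div_pos.2 hN') b m hm
    have h2 : (Z.filter fun k => ∀ j, k j ∈ Finset.Ico (b j) (b j + m)).card ≤
        85184 * D * m ^ 2 := by
      refine le_trans (Finset.card_le_card fun k hk => ?_) (h1.trans (le_of_eq (by norm_num)))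
      obtain ⟨hkZ, hkb⟩ := Finset.mem_filter.1 hk
      obtain ⟨y, hy, hyQ⟩ := (Finset.mem_filter.1 hkZ).2
      exact Finset.mem_filter.2 ⟨Fintype.mem_piFinset.2 hkb, _, hy, hyQ⟩
    exact_mod_cast h2
  have hnear : ∀ v ∈ V, ∀ k : Fin 3 → ℤ,
      (gridCube3 (1 / N) k ∩ {y | ∃ t : ℝ, y = x v + t • v}).Nonempty → ∀ j,
      |(k j : ℝ) - N * (x v j - x v i * w v j) - k i * w v j| ≤ 3 := by
    rintro v hv k ⟨_, hy, t, rfl⟩ j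
    have hvi : v i ≠ 0 := by
      have := hi v hv
      rw [← abs_pos]
      linarith
    have key : ∀ l, 0 ≤ N * (x v l + t * v l) - k l ∧ N * (x v l + t * v l) - k l ≤ 1 := by
      intro l
      obtain ⟨h1, h2⟩ := hy l
      rw [mul_one_div] at h1 h2
      rw [div_le_iff₀ hN'] at h1
      rw [le_div_iff₀ hN'] at h2
      simp only [PiLp.add_apply, PiLp.smul_apply, smul_eq_mul] at h1 h2
      constructor <;> linarith
    have h1 : (k j : ℝ) - N * (x v j - x v i * w v j) - k i * w v j =
        (N * (x v i + t * v i) - k i) * w v j - (N * (x v j + t * v j) - k j) := by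
      simp only [w]
      field_simp
      ring
    rw [h1]
    calc _ ≤ |(N * (x v i + t * v i) - k i) * w v j| + |N * (x v j + t * v j) - k j| := abs_sub _ _
      _ ≤ 1 * 2 + 1 := by
        rw [abs_mul, abs_of_nonneg (key i).1, abs_of_nonneg (key j).1]
        gcongr
        exacts [(key i).2, hw v hv j, (key j).2]
      _ = 3 := by norm_num
  let F : TubeFamily V (Fin 3 → ℤ) :=
    { N := N
      κ := 4
      c := c
      G := 85184 * D
      slope := fun v => (w v (i + 1), w v (i + 2))
      base := fun v => (N * (x v (i + 1) - x v i * w v (i + 1)),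
        N * (x v (i + 2) - x v i * w v (i + 2)))
      X := fun k => k (i + 1)
      Y := fun k => k (i + 2)
      T := fun k => k i
      Z := Z
      S := fun v => Z.filter fun k =>
        (gridCube3 (1 / N) k ∩ {y | ∃ t : ℝ, y = x v + t • v.1}).Nonempty
      N_pos := hN
      one_le_κ := by norm_num
      c_pos := hc
      c_le_one := hc1
      one_le_G := by linarith
      inj := fun k l h1 h2 h3 => by
        ext j
        obtain rfl | rfl | rfl := Fin.three_cases i j
        exacts [h3, h1, h2]
      norm_slope_le := fun v => max_le (hw v v.2 _) (hw v v.2 _)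
      separated := fun u v huv => by
        have h1 := hsep u u.2 v v.2 (Subtype.coe_ne_coe.2 huv)
        have h2 := dist_le_of_abs_slope_sub_le (hV u u.2) (hV v v.2) (hpos u u.2 v v.2)
          (η := ‖(w u (i + 1), w u (i + 2)) - (w v (i + 1), w v (i + 2))‖) (norm_nonneg _)
          fun j => by
            obtain rfl | rfl | rfl := Fin.three_cases i j
            · rw [div_self (left_ne_zero_of_mul (hpos u u.2 v v.2).ne'),
                div_self (right_ne_zero_of_mul (hpos u u.2 v v.2).ne'), sub_self, abs_zero]
              exact norm_nonneg _
            · exact le_max_left _ _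
            · exact le_max_right _ _
        have h3 : √(Fintype.card (Fin 3) : ℝ) ≤ 2 := by
          rw [Real.sqrt_le_left (by norm_num), Fintype.card_fin]
          norm_num
        have h4 := h1.trans (h2.trans (mul_le_mul_of_nonneg_left
          (mul_le_mul_of_nonneg_right h3 (norm_nonneg _)) zero_le_two))
        rw [div_le_iff₀ hN'] at h4
        rw [div_le_iff₀ (by positivity)]
        linarith
      subset := fun v => Finset.filter_subset _ _
      T_nonneg := fun k hk =>
        (Finset.mem_Ico.1 (Fintype.mem_piFinset.1 (Finset.mem_filter.1 hk).1 i)).1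
      T_lt := fun k hk =>
        (Finset.mem_Ico.1 (Fintype.mem_piFinset.1 (Finset.mem_filter.1 hk).1 i)).2
      near := fun v k hk =>
        max_le (hnear v v.2 k (Finset.mem_filter.1 hk).2 _)
          (hnear v v.2 k (Finset.mem_filter.1 hk).2 _)
      le_card := fun v => by
        refine (hx v v.2).trans (Nat.cast_le.2 ?_)
        rw [← Set.ncard_coe_finset]
        refine Set.ncard_le_ncard (fun k hk => ?_) (Finset.finite_toSet _)
        exact Finset.mem_coe.2 (Finset.mem_filter.2 ⟨Finset.mem_filter.2
          ⟨Fintype.mem_piFinset.2 (mem_Ico_of_gridCube3_subset hN hk.1), hk.2.2⟩, hk.2.1⟩)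
      card_le := by
        refine le_trans (Nat.cast_le.2 (Finset.card_le_card fun k hk => ?_)) (hbox N hN 0)
        refine Finset.mem_filter.2 ⟨hk, fun j => ?_⟩
        simpa using Fintype.mem_piFinset.1 (Finset.mem_filter.1 hk).1 j
      card_block_le := fun m hm a b h => by
        refine le_trans (Nat.cast_le.2 (Finset.card_le_card fun k hk => ?_))
          (hbox m hm fun j => if j = i then h else if j = i + 1 then a else b)
        obtain ⟨hkZ, h1, h2, h3⟩ := Finset.mem_filter.1 hk
        refine Finset.mem_filter.2 ⟨hkZ, fun j => ?_⟩
        obtain rfl | rfl | rfl := Fin.three_cases i j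
        · simpa using h3
        · simpa using h1
        · simpa using h2 }
  have := F.card_le_const hJ (by change 4 * 4 * (N : ℝ) < 2 ^ J; linarith)
  rwa [Fintype.card_coe] at this

theorem exists_half_le_abs_of_norm_eq_one {v : EuclideanSpace ℝ (Fin 3)} (hv : ‖v‖ = 1) :
    ∃ (i : Fin 3) (ε : ℤˣ), 1 / 2 ≤ ((ε : ℤ) : ℝ) * v i := by
  by_contra! h
  have h1 : ∀ i, v i ^ 2 < 1 / 4 := by
    intro i
    have h2 := h i 1
    have h3 := h i (-1)
    push_cast at h2 h3
    nlinarith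
  have h2 : ‖v‖ ^ 2 = v 0 ^ 2 + v 1 ^ 2 + v 2 ^ 2 := by
    rw [EuclideanSpace.norm_sq_eq, Fin.sum_univ_three]
    simp only [Real.norm_eq_abs, sq_abs]
  rw [hv] at h2
  linarith [h1 0, h1 1, h1 2]

theorem sixteen_mul_lt_two_pow_log (N : ℕ) : 16 * (N : ℝ) < 2 ^ (Nat.log 2 N + 5) := by
  have h1 : N < 2 ^ (Nat.log 2 N + 1) := Nat.lt_pow_succ_log_self one_lt_two N
  have h2 : 16 * N < 2 ^ (Nat.log 2 N + 5) := by
    rw [show Nat.log 2 N + 5 = Nat.log 2 N + 1 + 4 by ring, pow_add]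
    omega
  exact_mod_cast h2

theorem natLog_two_add_five_le {N : ℕ} (hN : 2 ≤ N) :
    ((Nat.log 2 N + 5 : ℕ) : ℝ) ≤ 12 * Real.log N := by
  have hl2 : 1 / 2 < Real.log 2 := by linarith [Real.log_two_gt_d9]
  have h1 : Real.log 2 ≤ Real.log N := Real.log_le_log zero_lt_two (by exact_mod_cast hN)
  have h2 : (Nat.log 2 N : ℝ) * Real.log 2 ≤ Real.log N := by
    rw [← Real.log_pow]
    refine Real.log_le_log (by positivity) ?_
    exact_mod_cast Nat.pow_log_le_self 2 (by omega)
  push_cast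
  nlinarith [Nat.cast_nonneg (α := ℝ) (Nat.log 2 N)]

/-- Hairbrush estimate in `ℝ³`: if `V ⊆ S²` is a `(1/N)`-separated set of directions
such that for each `v ∈ V` some line with direction `v` meets at least `c₀·N` of the
`1/N`-grid cubes inside `[0,1]³` in which the nonzero polynomial `Q` (of degree at
most `D`) has a zero, then `|V| ≤ C·D²·N·(log N)²`. -/
theorem hairbrush_singular_directions_bound
    (c₀ : ℝ) (hc₀ : 0 < c₀) :
    ∃ C : ℝ, 0 < C ∧
      ∀ N : ℕ, 2 ≤ N → ∀ D : ℕ, 0 < D →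
        ∀ Q : MvPolynomial (Fin 3) ℝ, Q ≠ 0 → Q.totalDegree ≤ D →
          ∀ V : Set (EuclideanSpace ℝ (Fin 3)), V.Finite →
            (∀ v ∈ V, ‖v‖ = 1) →
            (∀ u ∈ V, ∀ v ∈ V, u ≠ v → (1 : ℝ) / N ≤ dist u v) →
            (∀ v ∈ V, ∃ x : EuclideanSpace ℝ (Fin 3),
              c₀ * (N : ℝ) ≤
                (Set.ncard {k : Fin 3 → ℤ |
                    gridCube3 (1 / N) k ⊆ unitCube3 ∧
                    (gridCube3 (1 / N) k ∩ {y | ∃ t : ℝ, y = x + t • v}).Nonempty ∧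
                    ∃ y ∈ gridCube3 (1 / N) k,
                      MvPolynomial.eval (fun i => y i) Q = 0} : ℝ)) →
            (V.ncard : ℝ) ≤ C * (D : ℝ) ^ 2 * N * (Real.log N) ^ 2 := by
  classical
  have hc : 0 < min c₀ 1 := lt_min hc₀ one_pos
  have hB := TubeFamily.boundConst_pos four_pos hc
  refine ⟨6 * (TubeFamily.boundConst 4 (min c₀ 1) * 85184 ^ 2 * 12 ^ 2), by positivity, ?_⟩
  intro N hN D hD Q hQ hQD V hVfin hV hsep hline
  lift V to Finset (EuclideanSpace ℝ (Fin 3)) using hVfin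
  rw [Set.ncard_coe_finset]
  simp only [Finset.mem_coe] at hV hsep hline
  set J := Nat.log 2 N + 5 with hJ
  have hJlog : (J : ℝ) ≤ 12 * Real.log N := natLog_two_add_five_le hN
  let U : Fin 3 × ℤˣ → Finset (EuclideanSpace ℝ (Fin 3)) := fun p =>
    V.filter fun v => 1 / 2 ≤ ((p.2 : ℤ) : ℝ) * v p.1
  have hU : ∀ p, ((U p).card : ℝ) ≤
      TubeFamily.boundConst 4 (min c₀ 1) * (85184 * D) ^ 2 * J ^ 2 * N := by
    intro p
    have hUV : ∀ v ∈ U p, v ∈ V := fun v hv => (Finset.mem_filter.1 hv).1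
    have hUp : ∀ v ∈ U p, 1 / 2 ≤ ((p.2 : ℤ) : ℝ) * v p.1 := fun v hv => (Finset.mem_filter.1 hv).2
    have hp : ((p.2 : ℤ) : ℝ) = 1 ∨ ((p.2 : ℤ) : ℝ) = -1 := by
      rcases Int.units_eq_one_or p.2 with h | h <;> simp [h]
    refine card_transversal_directions_le hc (min_le_right _ _) (by omega) hD hQ hQD (U p)
      (fun v hv => hV v (hUV v hv)) (fun u hu v hv => hsep u (hUV u hu) v (hUV v hv))
      (fun v hv => ?_) p.1 (fun v hv => ?_) (fun u hu v hv => ?_) (by omega)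
      (sixteen_mul_lt_two_pow_log N)
    · obtain ⟨x, hx⟩ := hline v (hUV v hv)
      exact ⟨x, le_trans (by gcongr; exact min_le_left _ _) hx⟩
    · have := hUp v hv
      rcases hp with h | h <;> rw [h] at this <;> rw [le_abs]
      · left; linarith
      · right; linarith
    · have h1 := hUp u hu
      have h2 := hUp v hv
      rcases hp with h | h <;> rw [h] at h1 h2 <;> nlinarith
  have hcover : V ⊆ Finset.univ.biUnion U := by
    intro v hv
    obtain ⟨i, ε, h⟩ := exists_half_le_abs_of_norm_eq_one (hV v hv)
    exact Finset.mem_biUnion.2 ⟨(i, ε), Finset.mem_univ _, Finset.mem_filter.2 ⟨hv, h⟩⟩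
  calc (V.card : ℝ) ≤ (∑ p, (U p).card : ℕ) :=
        Nat.cast_le.2 ((Finset.card_le_card hcover).trans Finset.card_biUnion_le)
    _ = ∑ p, ((U p).card : ℝ) := Nat.cast_sum _ _
    _ ≤ ∑ _p : Fin 3 × ℤˣ, TubeFamily.boundConst 4 (min c₀ 1) * (85184 * D) ^ 2 * J ^ 2 * N :=
        Finset.sum_le_sum fun p _ => hU p
    _ = 6 * (TubeFamily.boundConst 4 (min c₀ 1) * (85184 * D) ^ 2 * J ^ 2 * N) := by
        rw [Finset.sum_const, nsmul_eq_mul]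
        congr 1
    _ ≤ 6 * (TubeFamily.boundConst 4 (min c₀ 1) * (85184 * D) ^ 2 * (12 * Real.log N) ^ 2 * N) := by
        gcongr
    _ = _ := by ring
end

section
/- There exists n₀ such that for every integer n ≥ n₀ there exist δ > 0, constants c > 0 and C > 0, and N₀ such that for every integer N ≥ N₀ there exist a finite set L of lines in ℝ^n and a finite set P ⊆ ℝ^n satisfying: (i) for every integer r with 1 < r < n and every r-dimensional affine subspace W ⊆ ℝ^n, the number of lines of L contained in W is at most C·N^{r-1}; (ii) every line l ∈ L satisfies c·N ≤ |P ∩ l| ≤ C·N; (iii) c·N^{n-1} ≤ |L| ≤ C·N^{n-1}; and (iv) |P| ≤ C·N^{n-δ}. Consequently, the naive high-dimensional generalization of Bourgain's conjecture (which would force |P| ≳ N^n under hypotheses (i)–(iii)) is false in all sufficiently large dimensions. -/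
/-- A line in `ℝ^n`: a set of the form `{x + t • v : t ∈ ℝ}` with `v ≠ 0`. -/
def IsLine' {n : ℕ} (l : Set (EuclideanSpace ℝ (Fin n))) : Prop :=
  ∃ (x v : EuclideanSpace ℝ (Fin n)), v ≠ 0 ∧ l = {y | ∃ t : ℝ, y = x + t • v}

theorem finrank_inf_ker_le {E : Type*} [AddCommGroup E] [Module ℝ E] [FiniteDimensional ℝ E]
    {D : Submodule ℝ E} {f : E →ₗ[ℝ] ℝ} {u : E} {d : ℕ} (hu : u ∈ D) (hfu : f u ≠ 0)
    (hD : Module.finrank ℝ D ≤ d + 1) :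
    Module.finrank ℝ (D ⊓ LinearMap.ker f : Submodule ℝ E) ≤ d := by
  have hlt : D ⊓ LinearMap.ker f < D :=
    lt_of_le_of_ne inf_le_left fun h => hfu (by
      have : u ∈ D ⊓ LinearMap.ker f := by rwa [h]
      exact this.2)
  have := Submodule.finrank_lt_finrank_of_lt hlt
  omega

/-- A finite set in a translate of a `d`-dimensional subspace, on which finitely many linear
functionals jointly separate points and each take at most `M` values, has at most `M ^ d`
elements. -/
theorem card_le_pow_finrank {E ι : Type*} [AddCommGroup E] [Module ℝ E] [FiniteDimensional ℝ E]
    (f : ι → E →ₗ[ℝ] ℝ) (M : ℕ) (hM : 1 ≤ M) (d : ℕ) :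
    ∀ (D : Submodule ℝ E) (P : Finset E), Module.finrank ℝ D ≤ d →
      (∀ p ∈ P, ∀ q ∈ P, p - q ∈ D) → (∀ i, (P.image (f i)).card ≤ M) →
      (∀ p ∈ P, ∀ q ∈ P, (∀ i, f i p = f i q) → p = q) → P.card ≤ M ^ d := by
  classical
  induction d with
  | zero =>
    intro D P hD hP _ _
    have hD0 : D = ⊥ := Submodule.finrank_eq_zero.mp (Nat.le_zero.mp hD)
    subst hD0
    rw [pow_zero, Finset.card_le_one]
    intro p hp q hq
    exact sub_eq_zero.mp ((Submodule.mem_bot ℝ).mp (hP p hp q hq))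
  | succ d ih =>
    intro D P hD hP hval hinj
    by_cases h : ∀ u ∈ D, ∀ i, f i u = 0
    · have : P.card ≤ 1 := Finset.card_le_one.mpr fun p hp q hq =>
        hinj p hp q hq fun i => by
          have := h _ (hP p hp q hq) i
          rwa [map_sub, sub_eq_zero] at this
      exact this.trans (Nat.one_le_pow _ _ hM)
    · push Not at h
      obtain ⟨u, hu, i, hi⟩ := h
      have hfib : ∀ c ∈ P.image (f i), (P.filter fun p => f i p = c).card ≤ M ^ d := by
        intro c _
        refine ih (D ⊓ LinearMap.ker (f i)) _ (finrank_inf_ker_le hu hi hD) ?_ ?_ ?_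
        · intro p hp q hq
          rw [Finset.mem_filter] at hp hq
          refine ⟨hP p hp.1 q hq.1, ?_⟩
          rw [SetLike.mem_coe, LinearMap.mem_ker, map_sub, hp.2, hq.2, sub_self]
        · exact fun j => (Finset.card_le_card
            (Finset.image_subset_image (Finset.filter_subset _ _))).trans (hval j)
        · exact fun p hp q hq =>
            hinj p (Finset.mem_filter.mp hp).1 q (Finset.mem_filter.mp hq).1
      calc P.card = ∑ c ∈ P.image (f i), (P.filter fun p => f i p = c).card :=
            Finset.card_eq_sum_card_image _ _
        _ ≤ ∑ _c ∈ P.image (f i), M ^ d := Finset.sum_le_sum hfib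
        _ = (P.image (f i)).card * M ^ d := by rw [Finset.sum_const, smul_eq_mul]
        _ ≤ M ^ (d + 1) := by
          rw [pow_succ']
          exact Nat.mul_le_mul_right _ (hval i)

/-- A nonzero real polynomial function of degree at most two has at most two zeros. -/
theorem card_zeros_quadratic_le_two {a b c : ℝ} (hc : c ≠ 0) (s : Finset ℝ)
    (hs : ∀ t ∈ s, a * t ^ 2 + b * t + c = 0) : s.card ≤ 2 := by
  classical
  have hne : (Polynomial.C a * Polynomial.X ^ 2 + Polynomial.C b * Polynomial.X +
      Polynomial.C c : Polynomial ℝ) ≠ 0 := by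
    intro h
    apply hc
    have := congrArg (Polynomial.eval 0) h
    simpa using this
  have h1 := Polynomial.card_le_degree_of_subset_roots
    (p := Polynomial.C a * Polynomial.X ^ 2 + Polynomial.C b * Polynomial.X + Polynomial.C c)
    (Z := s) (by
      intro t ht
      rw [Polynomial.mem_roots hne]
      simpa using hs t ht)
  exact h1.trans Polynomial.natDegree_quadratic_le

/-- Schwartz–Zippel bound for the zeros of a quadratic function on a translate of a subspace,
where the grid is described by linear functionals taking few values. -/
theorem mul_card_le_of_quadratic {E ι : Type*} [AddCommGroup E] [Module ℝ E]
    [FiniteDimensional ℝ E] (f : ι → E →ₗ[ℝ] ℝ) (M : ℕ) (hM : 1 ≤ M) (Q : E → ℝ)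
    (hQ : ∀ w u, ∃ a b : ℝ, ∀ t : ℝ, Q (w + t • u) = a * t ^ 2 + b * t + Q w) (d : ℕ) :
    ∀ (D : Submodule ℝ E) (w : E) (P : Finset E), Module.finrank ℝ D ≤ d → Q w ≠ 0 →
      (∀ p ∈ P, p - w ∈ D) → (∀ p ∈ P, Q p = 0) → (∀ i, (P.image (f i)).card ≤ M) →
      (∀ p ∈ P, ∀ q ∈ P, (∀ i, f i p = f i q) → p = q) → M * P.card ≤ 2 * d * M ^ d := by
  classical
  induction d with
  | zero =>
    intro D w P hD hw hP hPQ _ _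
    have hD0 : D = ⊥ := Submodule.finrank_eq_zero.mp (Nat.le_zero.mp hD)
    subst hD0
    have : P = ∅ := Finset.eq_empty_of_forall_notMem fun p hp => hw (by
      rw [← sub_eq_zero.mp ((Submodule.mem_bot ℝ).mp (hP p hp))]
      exact hPQ p hp)
    simp [this]
  | succ d ih =>
    intro D w P hD hw hP hPQ hval hinj
    have hsub : ∀ p ∈ P, ∀ q ∈ P, p - q ∈ D := fun p hp q hq => by
      have := D.sub_mem (hP p hp) (hP q hq)
      rwa [sub_sub_sub_cancel_right] at this
    by_cases h : ∀ u ∈ D, ∀ i, f i u = 0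
    · have h1 : P.card ≤ 1 := Finset.card_le_one.mpr fun p hp q hq =>
        hinj p hp q hq fun i => by
          have := h _ (hsub p hp q hq) i
          rwa [map_sub, sub_eq_zero] at this
      calc M * P.card ≤ M * 1 := Nat.mul_le_mul_left _ h1
        _ ≤ M * M ^ d := Nat.mul_le_mul_left _ (Nat.one_le_pow _ _ hM)
        _ = 1 * M ^ (d + 1) := by rw [pow_succ', one_mul]
        _ ≤ 2 * (d + 1) * M ^ (d + 1) := Nat.mul_le_mul_right _ (by omega)
    · push Not at h
      obtain ⟨u, hu, i, hi⟩ := h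
      obtain ⟨a, b, hab⟩ := hQ w u
      set τ : ℝ → ℝ := fun c => (c - f i w) / f i u with hτ
      have hτi : ∀ c, f i (w + τ c • u) = c := fun c => by
        simp only [map_add, map_smul, smul_eq_mul, hτ]
        field_simp
        ring
      have hker : ∀ c, ∀ p ∈ P.filter (fun p => f i p = c),
          p - (w + τ c • u) ∈ D ⊓ LinearMap.ker (f i) := by
        intro c p hp
        rw [Finset.mem_filter] at hp
        refine ⟨?_, ?_⟩
        · rw [← sub_sub]
          exact D.sub_mem (hP p hp.1) (D.smul_mem _ hu)
        · rw [SetLike.mem_coe, LinearMap.mem_ker, map_sub, hτi, hp.2, sub_self]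
      have hval' : ∀ c j, ((P.filter fun p => f i p = c).image (f j)).card ≤ M :=
        fun c j => (Finset.card_le_card
            (Finset.image_subset_image (Finset.filter_subset _ _))).trans (hval j)
      have hinj' : ∀ c, ∀ p ∈ P.filter (fun p => f i p = c),
          ∀ q ∈ P.filter (fun p => f i p = c), (∀ j, f j p = f j q) → p = q :=
        fun c p hp q hq =>
            hinj p (Finset.mem_filter.mp hp).1 q (Finset.mem_filter.mp hq).1
      have hfr := finrank_inf_ker_le hu hi hD
      set B := (P.image (f i)).filter fun c => Q (w + τ c • u) = 0 with hB
      have hBcard : B.card ≤ 2 := by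
        have hτinj : Set.InjOn τ B := by
          intro c _ c' _ hcc
          rw [← hτi c, ← hτi c', hcc]
        rw [← Finset.card_image_of_injOn hτinj]
        refine card_zeros_quadratic_le_two (a := a) (b := b) hw _ ?_
        intro t ht
        obtain ⟨c, hc, rfl⟩ := Finset.mem_image.mp ht
        rw [← hab]
        exact (Finset.mem_filter.mp hc).2
      have hfib : ∀ c ∈ P.image (f i), M * (P.filter fun p => f i p = c).card ≤
          2 * d * M ^ d + if Q (w + τ c • u) = 0 then M * M ^ d else 0 := by
        intro c _
        split_ifs with h0
        · refine le_add_left (Nat.mul_le_mul_left _ ?_)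
          refine card_le_pow_finrank f M hM d (D ⊓ LinearMap.ker (f i)) _ hfr ?_ (hval' c)
            (hinj' c)
          intro p hp q hq
          have := Submodule.sub_mem _ (hker c p hp) (hker c q hq)
          rwa [sub_sub_sub_cancel_right] at this
        · rw [add_zero]
          exact ih _ (w + τ c • u) _ hfr h0 (hker c)
            (fun p hp => hPQ p (Finset.mem_filter.mp hp).1) (hval' c) (hinj' c)
      calc M * P.card = ∑ c ∈ P.image (f i), M * (P.filter fun p => f i p = c).card := by
            rw [← Finset.mul_sum, ← Finset.card_eq_sum_card_image]
        _ ≤ ∑ c ∈ P.image (f i),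
              (2 * d * M ^ d + if Q (w + τ c • u) = 0 then M * M ^ d else 0) :=
            Finset.sum_le_sum hfib
        _ = (P.image (f i)).card * (2 * d * M ^ d) + B.card * (M * M ^ d) := by
            rw [Finset.sum_add_distrib, Finset.sum_const, smul_eq_mul, ← Finset.sum_filter,
              Finset.sum_const, smul_eq_mul]
        _ ≤ M * (2 * d * M ^ d) + 2 * (M * M ^ d) :=
            Nat.add_le_add (Nat.mul_le_mul_right _ (hval i)) (Nat.mul_le_mul_right _ hBcard)
        _ = 2 * (d + 1) * M ^ (d + 1) := by ring

theorem finrank_le_one_of_forall_eq_zero {E : Type*} [AddCommGroup E] [Module ℝ E]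
    {D : Submodule ℝ E} (f : E →ₗ[ℝ] ℝ) (hf : ∀ u ∈ D, f u = 0 → u = 0) :
    Module.finrank ℝ D ≤ 1 := by
  have hinj : Function.Injective (f.domRestrict D) := by
    rw [← LinearMap.ker_eq_bot, LinearMap.ker_eq_bot']
    exact fun u hu => Subtype.ext (hf u u.2 hu)
  simpa using LinearMap.finrank_le_finrank_of_injective hinj

/-- The `i`-th coordinate as a linear functional. -/
def coordFunctional {n : ℕ} (i : Fin n) : EuclideanSpace ℝ (Fin n) →ₗ[ℝ] ℝ where
  toFun x := x i
  map_add' _ _ := rfl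
  map_smul' _ _ := rfl

/-- The quadratic function vanishing on the graph `x₀ = ∑ yⱼ² - x₁ x₂`, where `yⱼ = x_{j+3}`. -/
def graphEq {k : ℕ} (x : EuclideanSpace ℝ (Fin (k + 3))) : ℝ :=
  ∑ j : Fin k, x j.succ.succ.succ ^ 2 - x 1 * x 2 - x 0

theorem graphEq_add_smul {k : ℕ} (w u : EuclideanSpace ℝ (Fin (k + 3))) (t : ℝ) :
    graphEq (w + t • u) = (∑ j : Fin k, u j.succ.succ.succ ^ 2 - u 1 * u 2) * t ^ 2 +
      (2 * ∑ j : Fin k, w j.succ.succ.succ * u j.succ.succ.succ - w 1 * u 2 - w 2 * u 1 - u 0) * t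
      + graphEq w := by
  have h : ∑ j : Fin k, (w j.succ.succ.succ + t * u j.succ.succ.succ) ^ 2 =
      (∑ j : Fin k, w j.succ.succ.succ ^ 2) +
      2 * t * (∑ j : Fin k, w j.succ.succ.succ * u j.succ.succ.succ) +
      t ^ 2 * ∑ j : Fin k, u j.succ.succ.succ ^ 2 := by
    rw [Finset.mul_sum, Finset.mul_sum, ← Finset.sum_add_distrib, ← Finset.sum_add_distrib]
    exact Finset.sum_congr rfl fun j _ => by ring
  simp only [graphEq, PiLp.add_apply, PiLp.smul_apply, smul_eq_mul, h]
  ring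

theorem eq_of_coords {k : ℕ} {x y : EuclideanSpace ℝ (Fin (k + 3))} (h0 : x 0 = y 0)
    (h1 : x 1 = y 1) (h2 : x 2 = y 2)
    (h3 : ∀ j : Fin k, x j.succ.succ.succ = y j.succ.succ.succ) : x = y := by
  ext i
  refine Fin.cases h0 (fun i => ?_) i
  refine Fin.cases h1 (fun i => ?_) i
  exact Fin.cases h2 h3 i

theorem eq_of_graphEq {k : ℕ} {x y : EuclideanSpace ℝ (Fin (k + 3))} (hx : graphEq x = 0)
    (hy : graphEq y = 0) (h : ∀ i : Fin (k + 2), x i.succ = y i.succ) : x = y := by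
  have h1 : x 1 = y 1 := h 0
  have h2 : x 2 = y 2 := h 1
  have h3 : ∀ j : Fin k, x j.succ.succ.succ = y j.succ.succ.succ := fun j => h j.succ.succ
  refine eq_of_coords ?_ h1 h2 h3
  simp only [graphEq, h1, h2, h3] at hx hy
  linarith

/-- The graph contains no affine subspace of dimension two or more. -/
theorem exists_graphEq_ne_zero {k : ℕ} (D : Submodule ℝ (EuclideanSpace ℝ (Fin (k + 3))))
    (hD : 2 ≤ Module.finrank ℝ D) (w : EuclideanSpace ℝ (Fin (k + 3))) :
    ∃ w', w' - w ∈ D ∧ graphEq w' ≠ 0 := by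
  by_contra! hcon
  have key : ∀ u ∈ D, (∑ j : Fin k, u j.succ.succ.succ ^ 2 - u 1 * u 2 = 0) ∧
      2 * ∑ j : Fin k, w j.succ.succ.succ * u j.succ.succ.succ - w 1 * u 2 - w 2 * u 1 - u 0
        = 0 := by
    intro u hu
    have h0 : graphEq w = 0 := hcon w (by simp)
    have h1 : graphEq (w + (1 : ℝ) • u) = 0 := hcon _ (by simpa using hu)
    have h2 : graphEq (w + (-1 : ℝ) • u) = 0 := hcon _ (by simpa using hu)
    rw [graphEq_add_smul, h0] at h1 h2
    constructor <;> linarith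
  have sq_zero : ∀ u ∈ D, u 1 = 0 → ∀ j : Fin k, u j.succ.succ.succ = 0 := by
    intro u hu hu1 j
    have h := (key u hu).1
    rw [hu1, zero_mul, sub_zero, Finset.sum_eq_zero_iff_of_nonneg fun _ _ => sq_nonneg _] at h
    exact pow_eq_zero_iff two_ne_zero |>.mp (h j (Finset.mem_univ j))
  have eq_zero : ∀ u ∈ D, u 1 = 0 → u 2 = 0 → u = 0 := by
    intro u hu hu1 hu2
    have h3 := sq_zero u hu hu1
    have h := (key u hu).2
    simp only [h3, hu1, hu2, mul_zero, Finset.sum_const_zero, sub_zero, zero_sub,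
      neg_eq_zero] at h
    exact eq_of_coords h hu1 hu2 h3
  by_cases hA : ∀ u ∈ D, u 1 = 0 → u = 0
  · have := finrank_le_one_of_forall_eq_zero (coordFunctional 1) hA
    omega
  · push Not at hA
    obtain ⟨u, hu, hu1, hu0⟩ := hA
    have hu2 : u 2 ≠ 0 := fun h => hu0 (eq_zero u hu hu1 h)
    have hall : ∀ v ∈ D, v 1 = 0 := by
      intro v hv
      have h := (key _ (D.add_mem hu hv)).1
      have hv' := (key v hv).1
      simp only [PiLp.add_apply, sq_zero u hu hu1, hu1, zero_add] at h
      have : u 2 * v 1 = 0 := by linarith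
      exact (mul_eq_zero.mp this).resolve_left hu2
    have := finrank_le_one_of_forall_eq_zero (coordFunctional 2)
      fun v hv => eq_zero v hv (hall v hv)
    omega

/-- At most `O(M ^ (r - 1))` points of a grid of side `M` on the graph lie in a given
`r`-dimensional affine subspace. -/
theorem mul_card_graph_le {k : ℕ} (M r : ℕ) (hM : 1 ≤ M) (hr : 2 ≤ r)
    (D : Submodule ℝ (EuclideanSpace ℝ (Fin (k + 3)))) (hD : Module.finrank ℝ D = r)
    (w : EuclideanSpace ℝ (Fin (k + 3))) (P : Finset (EuclideanSpace ℝ (Fin (k + 3))))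
    (hP : ∀ p ∈ P, p - w ∈ D) (hPQ : ∀ p ∈ P, graphEq p = 0)
    (hval : ∀ i : Fin (k + 2), (P.image fun p => p i.succ).card ≤ M) :
    P.card ≤ 2 * r * M ^ (r - 1) := by
  obtain ⟨w', hw', hne⟩ := exists_graphEq_ne_zero D (hD ▸ hr) w
  have h := mul_card_le_of_quadratic (fun i : Fin (k + 2) => coordFunctional i.succ) M hM graphEq
    (fun w u => ⟨_, _, graphEq_add_smul w u⟩) r D w' P hD.le hne
    (fun p hp => by
      have := D.sub_mem (hP p hp) hw'
      rwa [sub_sub_sub_cancel_right] at this) hPQ hval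
    (fun p hp q hq => eq_of_graphEq (hPQ p hp) (hPQ q hq))
  obtain ⟨s, rfl⟩ : ∃ s, r = s + 1 := ⟨r - 1, by omega⟩
  refine Nat.le_of_mul_le_mul_left (h.trans (le_of_eq ?_)) hM
  rw [Nat.add_sub_cancel]
  ring

section CurvePolynomial

open Polynomial

/-- The linear combination with coefficients `α, β, γ` of the coordinates of the curve
`(1, ∑ⱼ X^(2(j+1)), X, …, X^k)`. -/
noncomputable def curvePoly {k : ℕ} (α β : ℝ) (γ : Fin k → ℝ) : ℝ[X] :=
  C α + C β * ∑ j : Fin k, X ^ (2 * ((j : ℕ) + 1)) + ∑ j : Fin k, C (γ j) * X ^ ((j : ℕ) + 1)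

theorem natDegree_curvePoly_le {k : ℕ} (α β : ℝ) (γ : Fin k → ℝ) :
    (curvePoly α β γ).natDegree ≤ 2 * k := by
  unfold curvePoly
  refine natDegree_add_le_of_degree_le (natDegree_add_le_of_degree_le (by simp) ?_) ?_
  · refine (natDegree_C_mul_le _ _).trans (natDegree_sum_le_of_forall_le _ _ fun j _ => ?_)
    rw [natDegree_X_pow]
    omega
  · refine natDegree_sum_le_of_forall_le _ _ fun j _ => ?_
    refine (natDegree_C_mul_X_pow_le _ _).trans ?_
    omega

theorem coeffs_eq_zero_of_curvePoly_eq_zero {k : ℕ} (hk : 1 ≤ k) {α β : ℝ} {γ : Fin k → ℝ}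
    (h : curvePoly α β γ = 0) : α = 0 ∧ β = 0 ∧ ∀ j, γ j = 0 := by
  have hcoeff : ∀ m : ℕ, (if m = 0 then α else 0) +
      β * (∑ j : Fin k, if m = 2 * ((j : ℕ) + 1) then (1 : ℝ) else 0) +
      (∑ j : Fin k, if m = (j : ℕ) + 1 then γ j else 0) = 0 := by
    intro m
    have := congrArg (fun p => p.coeff m) h
    simpa [curvePoly, coeff_C, coeff_X_pow, finsetSum_coeff] using this
  have hβ : β = 0 := by
    have := hcoeff (2 * k)
    rw [if_neg (by omega), Finset.sum_eq_single ⟨k - 1, by omega⟩, if_pos (by simp; omega),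
      Finset.sum_eq_zero] at this
    · simpa using this
    · exact fun j _ => if_neg (by omega)
    · intro j _ hj
      refine if_neg fun h => hj (Fin.ext ?_)
      simp only
      omega
    · simp
  subst hβ
  refine ⟨?_, rfl, fun j => ?_⟩
  · simpa using hcoeff 0
  · have := hcoeff ((j : ℕ) + 1)
    rw [if_neg (by omega), zero_mul, add_zero, zero_add, Finset.sum_eq_single j,
      if_pos rfl] at this
    · exact this
    · exact fun i _ hi => if_neg fun h => hi (Fin.ext (by omega))
    · simp

end CurvePolynomial

/-- The moment-type curve of natural vectors, with an added coordinate making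
`(1, curve)` isotropic. -/
def curve (k τ : ℕ) : Fin (k + 1) → ℕ :=
  Fin.cons (∑ j : Fin k, τ ^ (2 * ((j : ℕ) + 1))) fun j => τ ^ ((j : ℕ) + 1)

/-- The direction at `x`, tangent to the graph, lying over the direction `(1, curve k τ)`. -/
def dirAt {k : ℕ} (x : EuclideanSpace ℝ (Fin (k + 3))) (τ : ℕ) :
    EuclideanSpace ℝ (Fin (k + 3)) :=
  WithLp.toLp 2 (Fin.cons (2 * ∑ j : Fin k, x j.succ.succ.succ * (τ : ℝ) ^ ((j : ℕ) + 1) -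
    x 2 - x 1 * ∑ j : Fin k, (τ : ℝ) ^ (2 * ((j : ℕ) + 1)))
      (Fin.cons 1 fun i => (curve k τ i : ℝ)))

theorem dirAt_zero {k : ℕ} (x : EuclideanSpace ℝ (Fin (k + 3))) (τ : ℕ) :
    dirAt x τ 0 = 2 * ∑ j : Fin k, x j.succ.succ.succ * (τ : ℝ) ^ ((j : ℕ) + 1) -
    x 2 - x 1 * ∑ j : Fin k, (τ : ℝ) ^ (2 * ((j : ℕ) + 1)) := rfl

theorem dirAt_one {k : ℕ} (x : EuclideanSpace ℝ (Fin (k + 3))) (τ : ℕ) : dirAt x τ 1 = 1 := rfl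

theorem dirAt_two {k : ℕ} (x : EuclideanSpace ℝ (Fin (k + 3))) (τ : ℕ) :
    dirAt x τ 2 = ∑ j : Fin k, (τ : ℝ) ^ (2 * ((j : ℕ) + 1)) := by
  have : dirAt x τ 2 = ((curve k τ 0 : ℕ) : ℝ) := rfl
  rw [this]
  simp [curve]

theorem dirAt_succ {k : ℕ} (x : EuclideanSpace ℝ (Fin (k + 3))) (τ : ℕ) (j : Fin k) :
    dirAt x τ j.succ.succ.succ = (τ : ℝ) ^ ((j : ℕ) + 1) := by
  have : dirAt x τ j.succ.succ.succ = ((curve k τ j.succ : ℕ) : ℝ) := rfl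
  rw [this]
  simp [curve]

theorem inner_dirAt {k : ℕ} (c x : EuclideanSpace ℝ (Fin (k + 3))) (τ : ℕ) :
    inner ℝ c (dirAt x τ) = (curvePoly (c 1 - c 0 * x 2) (c 2 - c 0 * x 1)
      fun j : Fin k => c j.succ.succ.succ + 2 * c 0 * x j.succ.succ.succ).eval (τ : ℝ) := by
  have h1 : c (Fin.succ 0) = c 1 := rfl
  have h2 : c (Fin.succ (Fin.succ 0)) = c 2 := rfl
  have h1' : dirAt x τ (Fin.succ 0) = dirAt x τ 1 := rfl
  have h2' : dirAt x τ (Fin.succ (Fin.succ 0)) = dirAt x τ 2 := rfl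
  rw [PiLp.inner_apply, Fin.sum_univ_succ, Fin.sum_univ_succ, Fin.sum_univ_succ, h1, h2, h1', h2']
  simp only [dirAt_zero, dirAt_one, dirAt_two, dirAt_succ, curvePoly, Polynomial.eval_add,
    Polynomial.eval_mul, Polynomial.eval_C, Polynomial.eval_finsetSum, Polynomial.eval_pow,
    Polynomial.eval_X, RCLike.inner_apply, conj_trivial, add_mul, Finset.sum_add_distrib]
  have h3 : ∑ j : Fin k, 2 * c 0 * x j.succ.succ.succ * (τ : ℝ) ^ ((j : ℕ) + 1) =
      2 * c 0 * ∑ j : Fin k, x j.succ.succ.succ * (τ : ℝ) ^ ((j : ℕ) + 1) := by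
    rw [Finset.mul_sum]
    exact Finset.sum_congr rfl fun j _ => by ring
  have h4 : ∑ j : Fin k, (τ : ℝ) ^ ((j : ℕ) + 1) * c j.succ.succ.succ =
      ∑ j : Fin k, c j.succ.succ.succ * (τ : ℝ) ^ ((j : ℕ) + 1) :=
    Finset.sum_congr rfl fun j _ => mul_comm _ _
  rw [h3, h4]
  ring

/-- Incidence bound: for points on the graph, all but at most one point have at most `2 * k` of
the special tangent directions inside a given proper subspace. -/
theorem card_incidences_le {k : ℕ} (hk : 1 ≤ k)
    (D : Submodule ℝ (EuclideanSpace ℝ (Fin (k + 3)))) (hD : D ≠ ⊤) (T : ℕ)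
    (P : Finset (EuclideanSpace ℝ (Fin (k + 3)))) (hPQ : ∀ p ∈ P, graphEq p = 0)
    (I : Finset (EuclideanSpace ℝ (Fin (k + 3)) × ℕ))
    (hI : ∀ z ∈ I, z.1 ∈ P ∧ z.2 < T ∧ dirAt z.1 z.2 ∈ D) :
    I.card ≤ 2 * k * P.card + T := by
  classical
  obtain ⟨c, hc, hc0⟩ : ∃ c ∈ Dᗮ, c ≠ 0 := by
    rw [← Submodule.ne_bot_iff]
    exact fun h => hD (Submodule.orthogonal_eq_bot_iff.mp h)
  set R : EuclideanSpace ℝ (Fin (k + 3)) → Polynomial ℝ := fun x =>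
    curvePoly (c 1 - c 0 * x 2) (c 2 - c 0 * x 1)
      fun j : Fin k => c j.succ.succ.succ + 2 * c 0 * x j.succ.succ.succ with hR
  have hmaps : ∀ z ∈ I, z.1 ∈ P := fun z hz => (hI z hz).1
  have hexc : (P.filter fun p => R p = 0).card ≤ 1 := by
    refine Finset.card_le_one.mpr fun p hp q hq => ?_
    rw [Finset.mem_filter] at hp hq
    obtain ⟨p1, p2, p3⟩ := coeffs_eq_zero_of_curvePoly_eq_zero hk hp.2
    obtain ⟨q1, q2, q3⟩ := coeffs_eq_zero_of_curvePoly_eq_zero hk hq.2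
    have hcz : c 0 ≠ 0 := by
      intro h
      simp only [h, zero_mul, sub_zero, mul_zero, add_zero] at p1 p2 p3
      exact hc0 (eq_of_coords h p1 p2 p3)
    refine eq_of_graphEq (hPQ p hp.1) (hPQ q hq.1) fun i => ?_
    refine Fin.cases ?_ (fun i => Fin.cases ?_ (fun i => ?_) i) i
    · exact mul_left_cancel₀ hcz (show c 0 * p 1 = c 0 * q 1 by linarith)
    · exact mul_left_cancel₀ hcz (show c 0 * p 2 = c 0 * q 2 by linarith)
    · exact mul_left_cancel₀ hcz (by linarith [p3 i, q3 i])
  have hfib : ∀ p ∈ P, (I.filter fun z => z.1 = p).card ≤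
      2 * k + if R p = 0 then T else 0 := by
    intro p _
    have hinj : Set.InjOn Prod.snd (↑(I.filter fun z => z.1 = p) : Set (EuclideanSpace ℝ (Fin (k + 3)) × ℕ)) := by
      intro z hz z' hz' h
      have h1 := (Finset.mem_filter.mp hz).2
      have h2 := (Finset.mem_filter.mp hz').2
      exact Prod.ext (h1.trans h2.symm) h
    rw [← Finset.card_image_of_injOn hinj]
    split_ifs with h0
    · refine le_add_left ?_
      rw [← Finset.card_range T]
      refine Finset.card_le_card fun τ hτ => ?_
      obtain ⟨z, hz, rfl⟩ := Finset.mem_image.mp hτ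
      exact Finset.mem_range.mpr (hI z (Finset.mem_filter.mp hz).1).2.1
    · rw [add_zero, ← Finset.card_image_of_injective _ (Nat.cast_injective (R := ℝ))]
      refine (Polynomial.card_le_degree_of_subset_roots (p := R p) ?_).trans
        (natDegree_curvePoly_le _ _ _)
      intro t ht
      obtain ⟨τ, hτ, rfl⟩ := Finset.mem_image.mp ht
      obtain ⟨z, hz, rfl⟩ := Finset.mem_image.mp hτ
      obtain ⟨hzI, rfl⟩ := Finset.mem_filter.mp hz
      rw [Polynomial.mem_roots h0, Polynomial.IsRoot, ← inner_dirAt]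
      exact (Submodule.mem_orthogonal' _ _).mp hc _ (hI z hzI).2.2
  calc I.card = ∑ p ∈ P, (I.filter fun z => z.1 = p).card :=
        Finset.card_eq_sum_card_fiberwise hmaps
    _ ≤ ∑ p ∈ P, (2 * k + if R p = 0 then T else 0) := Finset.sum_le_sum hfib
    _ = 2 * k * P.card + (P.filter fun p => R p = 0).card * T := by
      rw [Finset.sum_add_distrib, Finset.sum_const, smul_eq_mul, ← Finset.sum_filter,
        Finset.sum_const, smul_eq_mul, mul_comm]
    _ ≤ 2 * k * P.card + T :=
      Nat.add_le_add_left ((Nat.mul_le_mul_right _ hexc).trans (one_mul T).le) _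

/-- The point of the graph over the natural vector `(a, g)`. -/
def gridPoint {k : ℕ} (a : ℕ) (g : Fin (k + 1) → ℕ) : EuclideanSpace ℝ (Fin (k + 3)) :=
  WithLp.toLp 2 (Fin.cons (∑ j : Fin k, (g j.succ : ℝ) ^ 2 - a * g 0)
    (Fin.cons (a : ℝ) fun i => (g i : ℝ)))

theorem gridPoint_zero {k : ℕ} (a : ℕ) (g : Fin (k + 1) → ℕ) :
    gridPoint a g 0 = ∑ j : Fin k, (g j.succ : ℝ) ^ 2 - a * g 0 := rfl

theorem gridPoint_one {k : ℕ} (a : ℕ) (g : Fin (k + 1) → ℕ) : gridPoint a g 1 = a := rfl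

theorem gridPoint_two {k : ℕ} (a : ℕ) (g : Fin (k + 1) → ℕ) : gridPoint a g 2 = g 0 := rfl

theorem gridPoint_succ_succ {k : ℕ} (a : ℕ) (g : Fin (k + 1) → ℕ) (i : Fin (k + 1)) :
    gridPoint a g i.succ.succ = g i := rfl

theorem graphEq_gridPoint {k : ℕ} (a : ℕ) (g : Fin (k + 1) → ℕ) :
    graphEq (gridPoint a g) = 0 := by
  simp only [graphEq, gridPoint_zero, gridPoint_one, gridPoint_two, gridPoint_succ_succ]
  ring

theorem gridPoint_injective {k : ℕ} {a b : ℕ} {g h : Fin (k + 1) → ℕ}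
    (H : gridPoint a g = gridPoint b h) : a = b ∧ g = h := by
  refine ⟨?_, funext fun i => ?_⟩
  · have := congrArg (fun x => x 1) H
    simpa only [gridPoint_one, Nat.cast_inj] using this
  · have := congrArg (fun x => x i.succ.succ) H
    simpa only [gridPoint_succ_succ, Nat.cast_inj] using this

theorem curve_zero (k τ : ℕ) : curve k τ 0 = ∑ j : Fin k, τ ^ (2 * ((j : ℕ) + 1)) := rfl

theorem curve_succ (k τ : ℕ) (j : Fin k) : curve k τ j.succ = τ ^ ((j : ℕ) + 1) := rfl

theorem curve_le {k T τ : ℕ} (hτ : τ < T) (i : Fin (k + 1)) : curve k τ i ≤ k * T ^ (2 * k) := by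
  have hT : 1 ≤ T := by omega
  refine Fin.cases ?_ (fun j => ?_) i
  · rw [curve_zero]
    calc ∑ j : Fin k, τ ^ (2 * ((j : ℕ) + 1)) ≤ ∑ _j : Fin k, T ^ (2 * k) :=
          Finset.sum_le_sum fun j _ =>
            (Nat.pow_le_pow_left hτ.le _).trans (Nat.pow_le_pow_right hT (by omega))
      _ = k * T ^ (2 * k) := by simp
  · rw [curve_succ]
    calc τ ^ ((j : ℕ) + 1) ≤ T ^ (2 * k) :=
          (Nat.pow_le_pow_left hτ.le _).trans (Nat.pow_le_pow_right hT (by omega))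
      _ ≤ k * T ^ (2 * k) := Nat.le_mul_of_pos_left _ (by have := j.2; omega)

theorem sum_sq_line {k : ℕ} (y : Fin k → ℝ) (t s : ℝ) :
    ∑ j : Fin k, (y j + t * s ^ ((j : ℕ) + 1)) ^ 2 = ∑ j : Fin k, y j ^ 2 +
      2 * t * (∑ j : Fin k, y j * s ^ ((j : ℕ) + 1)) +
      t ^ 2 * ∑ j : Fin k, s ^ (2 * ((j : ℕ) + 1)) := by
  rw [Finset.mul_sum, Finset.mul_sum, ← Finset.sum_add_distrib, ← Finset.sum_add_distrib]
  exact Finset.sum_congr rfl fun j _ => by ring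

theorem gridPoint_add_smul {k : ℕ} (g : Fin (k + 1) → ℕ) (τ t : ℕ) :
    gridPoint 0 g + (t : ℝ) • dirAt (gridPoint 0 g) τ = gridPoint t (g + t • curve k τ) := by
  refine eq_of_coords ?_ ?_ ?_ fun j => ?_
  · simp only [PiLp.add_apply, PiLp.smul_apply, smul_eq_mul, gridPoint_zero, dirAt_zero,
      gridPoint_one, gridPoint_two, gridPoint_succ_succ, Pi.add_apply, Pi.smul_apply, curve_zero,
      curve_succ, Nat.cast_add, Nat.cast_mul, Nat.cast_pow, Nat.cast_sum, Nat.cast_zero,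
      sum_sq_line]
    ring
  · simp only [PiLp.add_apply, PiLp.smul_apply, smul_eq_mul, gridPoint_one, dirAt_one,
      Nat.cast_zero]
    ring
  · simp only [PiLp.add_apply, PiLp.smul_apply, smul_eq_mul, gridPoint_two, dirAt_two,
      Pi.add_apply, Pi.smul_apply, curve_zero, Nat.cast_add, Nat.cast_mul, Nat.cast_pow,
      Nat.cast_sum]
  · simp only [PiLp.add_apply, PiLp.smul_apply, smul_eq_mul, gridPoint_succ_succ, dirAt_succ,
      Pi.add_apply, Pi.smul_apply, curve_succ, Nat.cast_add, Nat.cast_mul, Nat.cast_pow]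

theorem dirAt_gridPoint_line {k : ℕ} (g : Fin (k + 1) → ℕ) (τ t : ℕ) :
    dirAt (gridPoint t (g + t • curve k τ)) τ = dirAt (gridPoint 0 g) τ := by
  refine eq_of_coords ?_ rfl (by rw [dirAt_two, dirAt_two])
    fun j => by rw [dirAt_succ, dirAt_succ]
  have h : ∑ j : Fin k, ((g j.succ : ℝ) + t * (τ : ℝ) ^ ((j : ℕ) + 1)) * (τ : ℝ) ^ ((j : ℕ) + 1) =
      ∑ j : Fin k, (g j.succ : ℝ) * (τ : ℝ) ^ ((j : ℕ) + 1) +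
        t * ∑ j : Fin k, (τ : ℝ) ^ (2 * ((j : ℕ) + 1)) := by
    rw [Finset.mul_sum, ← Finset.sum_add_distrib]
    exact Finset.sum_congr rfl fun j _ => by ring
  simp only [dirAt_zero, smul_eq_mul, gridPoint_one, gridPoint_two, gridPoint_succ_succ,
    Pi.add_apply, Pi.smul_apply, curve_zero, curve_succ, Nat.cast_add, Nat.cast_mul, Nat.cast_pow,
    Nat.cast_sum, Nat.cast_zero, h]
  ring

/-- The line on the graph through `gridPoint 0 g` lying over the direction `(1, curve k τ)`. -/
def gridLine {k : ℕ} (g : Fin (k + 1) → ℕ) (τ : ℕ) : Set (EuclideanSpace ℝ (Fin (k + 3))) :=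
  {y | ∃ t : ℝ, y = gridPoint 0 g + t • dirAt (gridPoint 0 g) τ}

theorem isLine_gridLine {k : ℕ} (g : Fin (k + 1) → ℕ) (τ : ℕ) : IsLine' (gridLine g τ) := by
  refine ⟨_, _, fun h => ?_, rfl⟩
  have := congrArg (fun x => x 1) h
  simp [dirAt_one] at this

theorem gridPoint_mem_gridLine {k : ℕ} (g : Fin (k + 1) → ℕ) (τ t : ℕ) :
    gridPoint t (g + t • curve k τ) ∈ gridLine g τ :=
  ⟨t, (gridPoint_add_smul g τ t).symm⟩

theorem eq_gridPoint_of_mem_gridLine {k : ℕ} {g : Fin (k + 1) → ℕ} {τ t : ℕ}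
    {y : EuclideanSpace ℝ (Fin (k + 3))} (hy : y ∈ gridLine g τ) (h1 : y 1 = t) :
    y = gridPoint t (g + t • curve k τ) := by
  obtain ⟨s, rfl⟩ := hy
  have : s = t := by simpa [dirAt_one, gridPoint_one] using h1
  rw [this, gridPoint_add_smul]

theorem gridLine_injective {k : ℕ} (hk : 1 ≤ k) {g h : Fin (k + 1) → ℕ} {τ σ : ℕ}
    (H : gridLine g τ = gridLine h σ) : g = h ∧ τ = σ := by
  have key : ∀ t : ℕ, g + t • curve k τ = h + t • curve k σ := fun t =>
    (gridPoint_injective (eq_gridPoint_of_mem_gridLine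
      (H ▸ gridPoint_mem_gridLine g τ t) (gridPoint_one _ _))).2
  have hgh : g = h := by simpa using key 0
  refine ⟨hgh, ?_⟩
  have h1 : curve k τ = curve k σ := by simpa [hgh] using key 1
  have h2 := congrFun h1 (Fin.succ ⟨0, hk⟩)
  simpa only [curve_succ, zero_add, pow_one] using h2

/-- The points of the graph over the box `[0, N) × [0, M)^(k+1)`. -/
noncomputable def gridSet (k N M : ℕ) : Finset (EuclideanSpace ℝ (Fin (k + 3))) := by
  classical
  exact (Finset.range N ×ˢ Fintype.piFinset fun _ : Fin (k + 1) => Finset.range M).image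
    fun z => gridPoint z.1 z.2

theorem mem_gridSet {k N M : ℕ} {x : EuclideanSpace ℝ (Fin (k + 3))} :
    x ∈ gridSet k N M ↔ ∃ a g, (a < N ∧ ∀ i, g i < M) ∧ gridPoint a g = x := by
  simp [gridSet]

theorem card_gridSet_le (k N M : ℕ) : (gridSet k N M).card ≤ N * M ^ (k + 1) := by
  refine Finset.card_image_le.trans (le_of_eq ?_)
  simp

theorem card_coord_gridSet_le {k N M : ℕ} (hNM : N ≤ M) (i : Fin (k + 2)) :
    ((gridSet k N M).image fun p => p i.succ).card ≤ M := by
  have : ((gridSet k N M).image fun p => p i.succ) ⊆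
      (Finset.range M).image fun m : ℕ => (m : ℝ) := by
    intro c hc
    obtain ⟨p, hp, rfl⟩ := Finset.mem_image.mp hc
    obtain ⟨a, g, ⟨ha, hg⟩, rfl⟩ := mem_gridSet.mp hp
    refine Fin.cases ?_ (fun i => ?_) i
    · exact Finset.mem_image.mpr ⟨a, Finset.mem_range.mpr (by omega), rfl⟩
    · exact Finset.mem_image.mpr ⟨g i, Finset.mem_range.mpr (hg i), rfl⟩
  exact (Finset.card_le_card this).trans (Finset.card_image_le.trans (Finset.card_range M).le)

theorem line_mem_gridSet {k N S T τ t : ℕ} {g : Fin (k + 1) → ℕ} (hS : S = k * T ^ (2 * k))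
    (hg : ∀ i, g i < N * S) (hτ : τ < T) (ht : t < N) :
    gridPoint t (g + t • curve k τ) ∈ gridSet k N (2 * N * S) := by
  refine mem_gridSet.mpr ⟨t, _, ⟨ht, fun i => ?_⟩, rfl⟩
  have h1 : t * curve k τ i ≤ N * S := Nat.mul_le_mul ht.le (hS ▸ curve_le hτ i)
  have h2 := hg i
  simp only [Pi.add_apply, Pi.smul_apply, smul_eq_mul]
  have h3 : 2 * N * S = N * S + N * S := by ring
  omega

theorem ncard_gridSet_inter_gridLine {k N S T τ : ℕ} {g : Fin (k + 1) → ℕ}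
    (hS : S = k * T ^ (2 * k)) (hg : ∀ i, g i < N * S) (hτ : τ < T) :
    ((gridSet k N (2 * N * S) : Set (EuclideanSpace ℝ (Fin (k + 3)))) ∩ gridLine g τ).ncard
      = N := by
  classical
  have heq : (gridSet k N (2 * N * S) : Set (EuclideanSpace ℝ (Fin (k + 3)))) ∩ gridLine g τ =
      ((Finset.range N).image fun t => gridPoint t (g + t • curve k τ) : Finset _) := by
    ext y
    simp only [Set.mem_inter_iff, Finset.mem_coe, Finset.mem_image, Finset.mem_range]
    constructor
    · rintro ⟨hy, hl⟩
      obtain ⟨a, h, ⟨ha, -⟩, rfl⟩ := mem_gridSet.mp hy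
      exact ⟨a, ha, (eq_gridPoint_of_mem_gridLine hl (gridPoint_one _ _)).symm⟩
    · rintro ⟨t, ht, rfl⟩
      exact ⟨line_mem_gridSet hS hg hτ ht, gridPoint_mem_gridLine _ _ _⟩
  rw [heq, Set.ncard_coe_finset, Finset.card_image_of_injective, Finset.card_range]
  exact fun s t h => (gridPoint_injective h).1

/-- Lines of the family contained in a given affine subspace. -/
theorem mul_card_lines_le {k N S T r : ℕ} (hk : 1 ≤ k) (hN : 1 ≤ N) (hT : 1 ≤ T)
    (hS : S = k * T ^ (2 * k)) (hr : 1 < r) (hrn : r < k + 3)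
    (W : AffineSubspace ℝ (EuclideanSpace ℝ (Fin (k + 3))))
    (hW : Module.finrank ℝ W.direction = r) (A : Finset ((Fin (k + 1) → ℕ) × ℕ))
    (hA : ∀ z ∈ A, (∀ i, z.1 i < N * S) ∧ z.2 < T)
    (hAW : ∀ z ∈ A, gridLine z.1 z.2 ⊆ (W : Set (EuclideanSpace ℝ (Fin (k + 3))))) :
    N * A.card ≤ 2 * k * (2 * r * (2 * N * S) ^ (r - 1)) + T := by
  classical
  have hS1 : 1 ≤ S := by
    rw [hS]
    exact Nat.mul_pos hk (Nat.pow_pos hT)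
  have hNM : N ≤ 2 * N * S := by
    calc N ≤ 2 * N := by omega
      _ ≤ 2 * N * S := Nat.le_mul_of_pos_right _ hS1
  rcases A.eq_empty_or_nonempty with rfl | ⟨z₀, hz₀⟩
  · simp
  have hw : gridPoint 0 (z₀.1 + 0 • curve k z₀.2) ∈ W :=
    hAW z₀ hz₀ (gridPoint_mem_gridLine _ _ 0)
  set w := gridPoint 0 (z₀.1 + 0 • curve k z₀.2)
  set P := (gridSet k N (2 * N * S)).filter fun p => p ∈ W with hP
  have hPQ : ∀ p ∈ P, graphEq p = 0 := by
    intro p hp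
    obtain ⟨a, g, -, rfl⟩ := mem_gridSet.mp (Finset.mem_filter.mp hp).1
    exact graphEq_gridPoint a g
  have hPcard : P.card ≤ 2 * r * (2 * N * S) ^ (r - 1) :=
    mul_card_graph_le (2 * N * S) r (hN.trans hNM) hr W.direction hW w P
      (fun p hp => AffineSubspace.vsub_mem_direction (Finset.mem_filter.mp hp).2 hw) hPQ
      (fun i => (Finset.card_le_card (Finset.image_subset_image (Finset.filter_subset _ _))).trans
        (card_coord_gridSet_le hNM i))
  have htop : W.direction ≠ ⊤ := by
    intro h
    rw [h, finrank_top, finrank_euclideanSpace_fin] at hW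
    omega
  set F : ((Fin (k + 1) → ℕ) × ℕ) × ℕ → EuclideanSpace ℝ (Fin (k + 3)) × ℕ :=
    fun z => (gridPoint z.2 (z.1.1 + z.2 • curve k z.1.2), z.1.2) with hF
  have hFinj : Function.Injective F := by
    rintro ⟨⟨g, τ⟩, t⟩ ⟨⟨h, σ⟩, s⟩ H
    obtain ⟨H1, H2⟩ := Prod.mk.inj H
    simp only at H1 H2
    subst H2
    obtain ⟨rfl, H3⟩ := gridPoint_injective H1
    rw [add_right_cancel H3]
  have hI : ∀ z ∈ (A ×ˢ Finset.range N).image F,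
      z.1 ∈ P ∧ z.2 < T ∧ dirAt z.1 z.2 ∈ W.direction := by
    intro z hz
    obtain ⟨⟨⟨g, τ⟩, t⟩, h, rfl⟩ := Finset.mem_image.mp hz
    obtain ⟨hgA, ht⟩ := Finset.mem_product.mp h
    obtain ⟨hg, hτ⟩ := hA _ hgA
    have hmem := fun t => hAW _ hgA (gridPoint_mem_gridLine g τ t)
    refine ⟨Finset.mem_filter.mpr
      ⟨line_mem_gridSet hS hg hτ (Finset.mem_range.mp ht), hmem t⟩, hτ, ?_⟩
    have h1 := AffineSubspace.vsub_mem_direction (hmem 1) (hmem 0)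
    rw [← gridPoint_add_smul, ← gridPoint_add_smul] at h1
    simp only [hF, dirAt_gridPoint_line]
    simpa using h1
  calc N * A.card = ((A ×ˢ Finset.range N).image F).card := by
        rw [Finset.card_image_of_injective _ hFinj, Finset.card_product, Finset.card_range,
          mul_comm]
    _ ≤ 2 * k * P.card + T := card_incidences_le hk W.direction htop T P hPQ _ hI
    _ ≤ _ := Nat.add_le_add_right (Nat.mul_le_mul_left _ hPcard) _

/-- The configuration of points and lines, with explicit bounds in terms of the parameters. -/
theorem exists_configuration {k N S T : ℕ} (hk : 1 ≤ k) (hN : 1 ≤ N) (hT : 1 ≤ T)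
    (hS : S = k * T ^ (2 * k)) (hlarge : N ≤ S ^ (k + 1) * T) :
    ∃ (L : Set (Set (EuclideanSpace ℝ (Fin (k + 3)))))
      (P : Set (EuclideanSpace ℝ (Fin (k + 3)))),
      L.Finite ∧ (∀ l ∈ L, IsLine' l) ∧ P.Finite ∧
      (∀ r : ℕ, 1 < r → r < k + 3 →
        ∀ W : AffineSubspace ℝ (EuclideanSpace ℝ (Fin (k + 3))),
          Module.finrank ℝ W.direction = r →
          N * {l ∈ L | l ⊆ (W : Set (EuclideanSpace ℝ (Fin (k + 3))))}.ncard
            ≤ 2 * k * (2 * r * (2 * N * S) ^ (r - 1)) + T) ∧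
      (∀ l ∈ L, (P ∩ l).ncard = N) ∧ L.ncard = N ^ (k + 2) ∧
      P.ncard ≤ N * (2 * N * S) ^ (k + 1) := by
  classical
  obtain ⟨A, hAsub, hAcard⟩ : ∃ A ⊆ (Fintype.piFinset fun _ : Fin (k + 1) =>
      Finset.range (N * S)) ×ˢ Finset.range T, A.card = N ^ (k + 2) := by
    refine Finset.exists_subset_card_eq ?_
    rw [Finset.card_product, Fintype.card_piFinset_const, Finset.card_range, Finset.card_range]
    calc N ^ (k + 2) = N ^ (k + 1) * N := pow_succ _ _
      _ ≤ N ^ (k + 1) * (S ^ (k + 1) * T) := Nat.mul_le_mul_left _ hlarge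
      _ = (N * S) ^ (k + 1) * T := by ring
  have hA : ∀ z ∈ A, (∀ i, z.1 i < N * S) ∧ z.2 < T := by
    intro z hz
    simpa using hAsub hz
  have hinj : Function.Injective
      fun z : (Fin (k + 1) → ℕ) × ℕ => (gridLine z.1 z.2 : Set _) := fun z z' h =>
    Prod.ext (gridLine_injective hk h).1 (gridLine_injective hk h).2
  refine ⟨(A.image fun z => gridLine z.1 z.2 : Finset _), gridSet k N (2 * N * S),
    Finset.finite_toSet _, ?_, Finset.finite_toSet _, ?_, ?_, ?_, ?_⟩
  · intro l hl
    obtain ⟨z, -, rfl⟩ := Finset.mem_image.mp (Finset.mem_coe.mp hl)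
    exact isLine_gridLine _ _
  · intro r hr hrn W hW
    have heq : {l ∈ ((A.image fun z => gridLine z.1 z.2 : Finset _) : Set (Set _)) |
        l ⊆ (W : Set (EuclideanSpace ℝ (Fin (k + 3))))} =
        ((A.filter fun z => gridLine z.1 z.2 ⊆
          (W : Set (EuclideanSpace ℝ (Fin (k + 3))))).image
          fun z => gridLine z.1 z.2 : Finset _) := by
      ext l
      simp only [Finset.coe_image, Set.mem_image, Finset.mem_coe, Set.mem_ofPred_eq,
        Finset.mem_filter]
      constructor
      · rintro ⟨⟨z, hz, rfl⟩, h⟩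
        exact ⟨z, ⟨hz, h⟩, rfl⟩
      · rintro ⟨z, ⟨hz, h⟩, rfl⟩
        exact ⟨⟨z, hz, rfl⟩, h⟩
    rw [heq, Set.ncard_coe_finset, Finset.card_image_of_injective _ hinj]
    exact mul_card_lines_le hk hN hT hS hr hrn W hW _
      (fun z hz => hA z (Finset.mem_filter.mp hz).1) fun z hz => (Finset.mem_filter.mp hz).2
  · intro l hl
    obtain ⟨z, hz, rfl⟩ := Finset.mem_image.mp (Finset.mem_coe.mp hl)
    exact ncard_gridSet_inter_gridLine hS (hA z hz).1 (hA z hz).2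
  · rw [Set.ncard_coe_finset, Finset.card_image_of_injective _ hinj, hAcard]
  · rw [Set.ncard_coe_finset]
    exact card_gridSet_le _ _ _

/-- A choice of integer parameter comparable to `N ^ (1 / (e + 1))`. -/
theorem exists_nat_root (e N : ℕ) (hN : 1 ≤ N) : ∃ T : ℕ, 1 ≤ T ∧ N ≤ T ^ (e + 1) ∧
    T ≤ 2 * N ∧ (T : ℝ) ^ e ≤ 2 ^ e * (N : ℝ) ^ (1 - 1 / ((e : ℝ) + 1)) := by
  have hN1 : (1 : ℝ) ≤ N := by exact_mod_cast hN
  have hN0 : (0 : ℝ) ≤ N := by linarith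
  have he : (0 : ℝ) < (e : ℝ) + 1 := by positivity
  set x : ℝ := (N : ℝ) ^ (1 / ((e : ℝ) + 1)) with hx
  have hx1 : 1 ≤ x := Real.one_le_rpow hN1 (by positivity)
  have hxN : x ≤ N := by
    calc x ≤ (N : ℝ) ^ (1 : ℝ) := Real.rpow_le_rpow_of_exponent_le hN1 (by
          rw [div_le_one he]; linarith [Nat.cast_nonneg (α := ℝ) e])
      _ = N := Real.rpow_one _
  have hxpow : x ^ (e + 1) = N := by
    rw [hx, ← Real.rpow_natCast, ← Real.rpow_mul hN0]
    push_cast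
    rw [one_div_mul_cancel he.ne', Real.rpow_one]
  have hle : x ≤ ⌈x⌉₊ := Nat.le_ceil x
  have hlt : (⌈x⌉₊ : ℝ) ≤ 2 * x := by
    have := Nat.ceil_lt_add_one (a := x) (by linarith)
    linarith
  refine ⟨⌈x⌉₊, ?_, ?_, ?_, ?_⟩
  · exact_mod_cast hx1.trans hle
  · have : (N : ℝ) ≤ (⌈x⌉₊ : ℝ) ^ (e + 1) :=
      hxpow ▸ pow_le_pow_left₀ (by linarith) hle _
    exact_mod_cast this
  · have : (⌈x⌉₊ : ℝ) ≤ 2 * N := by linarith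
    exact_mod_cast this
  · calc (⌈x⌉₊ : ℝ) ^ e ≤ (2 * x) ^ e := pow_le_pow_left₀ (by positivity) hlt _
      _ = 2 ^ e * x ^ e := mul_pow _ _ _
      _ = 2 ^ e * (N : ℝ) ^ (1 - 1 / ((e : ℝ) + 1)) := by
        rw [hx, ← Real.rpow_natCast (_ ^ _) e, ← Real.rpow_mul hN0]
        congr 2
        field_simp
        ring

/-- Counterexample to the naive high-dimensional generalization of Bourgain's
conjecture: for all sufficiently large `n` there are configurations of `∼ N^{n-1}`
lines in `ℝ^n`, no more than `C·N^{r-1}` of which lie in any `r`-dimensional affine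
subspace (`1 < r < n`), each containing `∼ N` points of a set `P`, and yet
`|P| ≤ C·N^{n-δ}` for some `δ = δ(n) > 0`. -/
theorem naive_bourgain_counterexample :
    ∃ n₀ : ℕ, ∀ n : ℕ, n₀ ≤ n →
      ∃ (δ c C : ℝ), 0 < δ ∧ 0 < c ∧ 0 < C ∧
        ∃ N₀ : ℕ, ∀ N : ℕ, N₀ ≤ N →
          ∃ (L : Set (Set (EuclideanSpace ℝ (Fin n))))
            (P : Set (EuclideanSpace ℝ (Fin n))),
            L.Finite ∧ (∀ l ∈ L, IsLine' l) ∧ P.Finite ∧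
            (∀ r : ℕ, 1 < r → r < n →
              ∀ W : AffineSubspace ℝ (EuclideanSpace ℝ (Fin n)),
                Module.finrank ℝ W.direction = r →
                ({l ∈ L | l ⊆ (W : Set (EuclideanSpace ℝ (Fin n)))}.ncard : ℝ)
                  ≤ C * (N : ℝ) ^ (r - 1)) ∧
            (∀ l ∈ L, c * (N : ℝ) ≤ ((P ∩ l).ncard : ℝ) ∧
              ((P ∩ l).ncard : ℝ) ≤ C * (N : ℝ)) ∧
            (c * (N : ℝ) ^ (n - 1) ≤ (L.ncard : ℝ) ∧
              (L.ncard : ℝ) ≤ C * (N : ℝ) ^ (n - 1)) ∧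
            (P.ncard : ℝ) ≤ C * (N : ℝ) ^ ((n : ℝ) - δ) := by
  refine ⟨4, fun n hn => ?_⟩
  obtain ⟨k, rfl⟩ : ∃ k, n = k + 3 := ⟨n - 3, by omega⟩
  have hk : 1 ≤ k := by omega
  set e := 2 * k * (k + 1) with he
  set δ : ℝ := 1 / ((e : ℝ) + 1) with hδ
  have hδ0 : 0 < δ := by positivity
  set K : ℝ := (k : ℝ) ^ (k + 1) * 2 ^ e with hK
  have hK0 : 0 ≤ K := by positivity
  set C : ℝ := 2 ^ (k + 1) * K * (4 * k * (k + 3) + 1) + 2 with hC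
  have hC2 : 2 ≤ C := by
    have : 0 ≤ 2 ^ (k + 1) * K * (4 * k * (k + 3) + 1) := by positivity
    linarith
  refine ⟨δ, 1, C, hδ0, one_pos, by linarith, 1, fun N hN => ?_⟩
  obtain ⟨T, hT, hNT, hT2, hTe⟩ := exists_nat_root e N hN
  set S := k * T ^ (2 * k) with hS
  have hSpow : S ^ (k + 1) = k ^ (k + 1) * T ^ e := by rw [hS, mul_pow, ← pow_mul, he]
  have hlarge : N ≤ S ^ (k + 1) * T := by
    calc N ≤ T ^ (e + 1) := hNT
      _ = 1 * T ^ e * T := by ring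
      _ ≤ S ^ (k + 1) * T := by
        rw [hSpow]
        gcongr
        exact Nat.one_le_pow _ _ hk
  obtain ⟨L, P, hL, hline, hP, hW, hPl, hLcard, hPcard⟩ :=
    exists_configuration hk hN hT hS hlarge
  have hN1 : (1 : ℝ) ≤ N := by exact_mod_cast hN
  have hN0 : (0 : ℝ) < N := by linarith
  have hSK : (S : ℝ) ^ (k + 1) ≤ K * (N : ℝ) ^ (1 - δ) := by
    have : (S : ℝ) ^ (k + 1) = (k : ℝ) ^ (k + 1) * (T : ℝ) ^ e := by exact_mod_cast hSpow
    rw [this, hK, mul_assoc]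
    gcongr
  have hSN : (S : ℝ) ^ (k + 1) ≤ K * N := by
    refine hSK.trans (mul_le_mul_of_nonneg_left ?_ hK0)
    calc (N : ℝ) ^ (1 - δ) ≤ (N : ℝ) ^ (1 : ℝ) :=
          Real.rpow_le_rpow_of_exponent_le hN1 (by linarith)
      _ = N := Real.rpow_one _
  have hS1 : (1 : ℝ) ≤ S := by
    have : 1 ≤ S := Nat.mul_pos hk (Nat.pow_pos hT)
    exact_mod_cast this
  refine ⟨L, P, hL, hline, hP, ?_, ?_, ?_, ?_⟩
  · intro r hr hrn W hWr
    have h := hW r hr hrn W hWr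
    obtain ⟨s, rfl⟩ : ∃ s, r = s + 1 := ⟨r - 1, by omega⟩
    rw [Nat.add_sub_cancel] at h ⊢
    set m := {l ∈ L | l ⊆ (W : Set (EuclideanSpace ℝ (Fin (k + 3))))}.ncard
    have h' : (N : ℝ) * m ≤ 2 * k * (2 * (s + 1) * (2 * N * S) ^ s) + T := by exact_mod_cast h
    have hT' : (T : ℝ) ≤ 2 * N := by exact_mod_cast hT2
    have hs : (s : ℝ) + 1 ≤ k + 3 := by
      have : s + 1 ≤ k + 3 := by omega
      exact_mod_cast this
    have hpow : (2 * N * S : ℝ) ^ s ≤ 2 ^ (k + 1) * (N : ℝ) ^ s * (K * N) := by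
      rw [mul_pow, mul_pow]
      gcongr
      · norm_num
      · omega
      · exact (pow_le_pow_right₀ hS1 (by omega)).trans hSN
    have hNs : (1 : ℝ) ≤ (N : ℝ) ^ s := one_le_pow₀ hN1
    have h2 : (N : ℝ) * m ≤ N * (C * (N : ℝ) ^ s) := by
      calc (N : ℝ) * m ≤ 2 * k * (2 * (s + 1) * (2 * N * S) ^ s) + T := h'
        _ ≤ 2 * k * (2 * (k + 3) * (2 ^ (k + 1) * (N : ℝ) ^ s * (K * N))) + 2 * N := by gcongr
        _ ≤ 2 * k * (2 * (k + 3) * (2 ^ (k + 1) * (N : ℝ) ^ s * (K * N)))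
            + 2 * N * (N : ℝ) ^ s + 2 ^ (k + 1) * K * N * (N : ℝ) ^ s := by
          have h3 : 2 * (N : ℝ) ≤ 2 * N * (N : ℝ) ^ s :=
            le_mul_of_one_le_right (by positivity) hNs
          have h4 : 0 ≤ 2 ^ (k + 1) * K * N * (N : ℝ) ^ s := by positivity
          linarith
        _ = N * (C * (N : ℝ) ^ s) := by rw [hC]; ring
    exact le_of_mul_le_mul_left h2 hN0
  · intro l hl
    rw [hPl l hl]
    constructor <;> nlinarith
  · rw [hLcard, show k + 3 - 1 = k + 2 from rfl]
    push_cast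
    have : (0 : ℝ) < (N : ℝ) ^ (k + 2) := by positivity
    constructor <;> nlinarith
  · have hrpow : (N : ℝ) ^ (((k + 3 : ℕ) : ℝ) - δ) = (N : ℝ) ^ (k + 2) * (N : ℝ) ^ (1 - δ) := by
      rw [← Real.rpow_natCast, ← Real.rpow_add hN0]
      congr 1
      push_cast
      ring
    have hP' : (P.ncard : ℝ) ≤ N * (2 * N * S) ^ (k + 1) := by exact_mod_cast hPcard
    have hKC : 2 ^ (k + 1) * K ≤ C := by
      have : 0 ≤ 2 ^ (k + 1) * K * (4 * k * (k + 3)) := by positivity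
      rw [hC]
      linarith
    calc (P.ncard : ℝ) ≤ N * (2 * N * S) ^ (k + 1) := hP'
      _ = 2 ^ (k + 1) * (N : ℝ) ^ (k + 2) * (S : ℝ) ^ (k + 1) := by ring
      _ ≤ 2 ^ (k + 1) * (N : ℝ) ^ (k + 2) * (K * (N : ℝ) ^ (1 - δ)) := by gcongr
      _ = 2 ^ (k + 1) * K * ((N : ℝ) ^ (k + 2) * (N : ℝ) ^ (1 - δ)) := by ring
      _ ≤ C * (N : ℝ) ^ (((k + 3 : ℕ) : ℝ) - δ) := by
        rw [hrpow]
        gcongr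
end
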